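/- arXiv:2302.06437 — 9 statements merged into one kernel-verified Lean document; each statement's English description precedes it below -/
import Mathlib

section
/- Let X be a Hausdorff semi-regular topological space such that the space Q_p(X,ℝ) of quasicontinuous real-valued functions on X with the topology of pointwise convergence is Fréchet–Urysohn. Then for every minimally bounded subset W of X, the set cl(W) \ W is countable. -/
open Set Filter Topology

section Defs

variable {X : Type*}

/-- `f : X → ℝ` is quasicontinuous: for every `x` and open sets `U ∋ x`, `V ∋ f x`
there is a nonempty open `W ⊆ U` with `f '' W ⊆ V`. -/
def Quasicontinuous [TopologicalSpace X] (f : X → ℝ) : Prop :=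
  ∀ x : X, ∀ U : Set X, IsOpen U → x ∈ U → ∀ V : Set ℝ, IsOpen V → f x ∈ V →
    ∃ W : Set X, IsOpen W ∧ W.Nonempty ∧ W ⊆ U ∧ f '' W ⊆ V

/-- `Q_p(X, ℝ)`: the quasicontinuous functions with the topology of pointwise
convergence (subspace of the product topology on `X → ℝ`). -/
abbrev Qp (X : Type*) [TopologicalSpace X] : Type _ :=
  {f : X → ℝ // Quasicontinuous f}

/-- A space is semi-regular if the regular open sets (`U = int (cl U)`) form a base. -/
def SemiRegular (X : Type*) [TopologicalSpace X] : Prop :=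
  TopologicalSpace.IsTopologicalBasis {U : Set X | U = interior (closure U)}

/-- Open Whyburn space. -/
def OpenWhyburn (X : Type*) [TopologicalSpace X] : Prop :=
  ∀ A : Set X, IsOpen A → ∀ x ∈ closure A \ A,
    ∃ B : Set X, IsOpen B ∧ B ⊆ A ∧ closure B \ A = {x}

/-- A set `A` is minimally bounded if `A ⊆ cl (int A)` and `int (cl A) ⊆ A`. -/
def MinimallyBounded [TopologicalSpace X] (A : Set X) : Prop :=
  A ⊆ closure (interior A) ∧ interior (closure A) ⊆ A

end Defs

/-- The indicator function of a minimally bounded set is quasicontinuous. -/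
theorem MinimallyBounded.quasicontinuous_indicator {X : Type*} [TopologicalSpace X] {A : Set X}
    (hA : MinimallyBounded A) : Quasicontinuous (A.indicator (1 : X → ℝ)) := by
  intro x U hU hxU V _ hfx
  by_cases hx : x ∈ A
  · refine ⟨U ∩ interior A, hU.inter isOpen_interior, ?_, inter_subset_left, ?_⟩
    · exact mem_closure_iff.1 (hA.1 hx) U hU hxU
    · rintro _ ⟨y, ⟨_, hy⟩, rfl⟩
      simpa [hx, interior_subset hy] using hfx
  · have hx' : x ∈ closure (closure A)ᶜ := by
      rw [closure_compl]
      exact fun h => hx (hA.2 h)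
    refine ⟨U ∩ (closure A)ᶜ, hU.inter isClosed_closure.isOpen_compl, ?_, inter_subset_left, ?_⟩
    · exact mem_closure_iff.1 hx' U hU hxU
    · rintro _ ⟨y, ⟨_, hy⟩, rfl⟩
      have hyA : y ∉ A := fun h => hy (subset_closure h)
      simpa [hx, hyA] using hfx

/-- Adding points of the closure preserves minimal boundedness. -/
theorem MinimallyBounded.of_subset_closure {X : Type*} [TopologicalSpace X] {A B : Set X}
    (hA : MinimallyBounded A) (hAB : A ⊆ B) (hB : B ⊆ closure A) : MinimallyBounded B := by
  constructor
  · exact hB.trans ((closure_minimal hA.1 isClosed_closure).trans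
      (closure_mono (interior_mono hAB)))
  · exact (interior_mono (closure_minimal hB isClosed_closure)).trans (hA.2.trans hAB)

theorem qp_frechetUrysohn_minimallyBounded_boundary_countable
    (X : Type*) [TopologicalSpace X] [T2Space X] (hsr : SemiRegular X)
    (hFU : FrechetUrysohnSpace (Qp X)) :
    ∀ W : Set X, MinimallyBounded W → (closure W \ W).Countable := by
  classical
  intro W hW
  have hq : ∀ B : Set X, W ⊆ B → B ⊆ closure W →
      Quasicontinuous (B.indicator (1 : X → ℝ)) := fun B h₁ h₂ =>
    (hW.of_subset_closure h₁ h₂).quasicontinuous_indicator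
  let g : Qp X := ⟨(closure W).indicator 1, hq _ subset_closure subset_rfl⟩
  let v : Finset X → Qp X := fun F => ⟨(W ∪ (↑F ∩ closure W)).indicator 1,
    hq _ subset_union_left (union_subset subset_closure inter_subset_right)⟩
  have hv : Tendsto v atTop (𝓝 g) := by
    refine tendsto_subtype_rng.2 (tendsto_pi_nhds.2 fun x => ?_)
    refine tendsto_const_nhds.congr' ?_
    filter_upwards [eventually_ge_atTop {x}] with F hF
    have hxF : x ∈ F := by simpa using hF
    have hiff : x ∈ W ∪ (↑F ∩ closure W) ↔ x ∈ closure W := by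
      simpa [hxF] using fun h : x ∈ W => subset_closure h
    simp only [g, v, indicator_apply, hiff]
  have hg : g ∈ closure (range v) := mem_closure_of_tendsto hv (.of_forall mem_range_self)
  obtain ⟨u, huS, hu⟩ := mem_closure_iff_seq_limit.1 hg
  choose F hF using huS
  refine (countable_iUnion fun n => (F n).countable_toSet).mono ?_
  rintro x ⟨hx, hxW⟩
  have hlim : Tendsto (fun n => (u n).1 x) atTop (𝓝 1) := by
    have h := ((continuous_apply x).comp continuous_subtype_val).tendsto g |>.comp hu
    simpa [g, hx, Function.comp_def] using h
  obtain ⟨n, hn⟩ := (hlim.eventually_ne one_ne_zero).exists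
  rw [← hF n] at hn
  have := mem_of_indicator_ne_zero hn
  exact mem_iUnion.2 ⟨n, (this.resolve_left hxW).1⟩
end

section
/- Let X be a Hausdorff semi-regular open Whyburn space such that the space Q_p(X,ℝ) of quasicontinuous real-valued functions on X with the topology of pointwise convergence is Fréchet–Urysohn. Then every nowhere dense subset of X is countable. -/
open Set Filter Topology

/-- The indicator function of the closure of an open set is quasicontinuous. -/
theorem quasicontinuous_indicator_closure {X : Type*} [TopologicalSpace X] {O : Set X}
    (hO : IsOpen O) : Quasicontinuous ((closure O).indicator (1 : X → ℝ)) := by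
  intro x U hU hxU V _ hxV
  by_cases hx : x ∈ closure O
  · refine ⟨U ∩ O, hU.inter hO, mem_closure_iff.1 hx U hU hxU, inter_subset_left, ?_⟩
    rintro _ ⟨y, hy, rfl⟩
    rw [indicator_of_mem hx] at hxV
    rw [indicator_of_mem (subset_closure hy.2)]
    exact hxV
  · refine ⟨U \ closure O, hU.sdiff isClosed_closure, ⟨x, hxU, hx⟩, sdiff_subset, ?_⟩
    rintro _ ⟨y, hy, rfl⟩
    rw [indicator_of_notMem hx] at hxV
    rw [indicator_of_notMem hy.2]
    exact hxV

/-- In a Hausdorff open Whyburn space, every point of an open set `U` lies in a regular closed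
subset of `U`. -/
theorem OpenWhyburn.exists_isOpen_closure_subset {X : Type*} [TopologicalSpace X] [T2Space X]
    (hw : OpenWhyburn X) {U : Set X} (hU : IsOpen U) {x : X} (hx : x ∈ U) :
    ∃ B : Set X, IsOpen B ∧ x ∈ closure B ∧ closure B ⊆ U := by
  by_cases hcl : x ∈ closure (U \ {x})
  · obtain ⟨B, hB, -, hBx⟩ := hw (U \ {x}) (hU.sdiff isClosed_singleton) x ⟨hcl, by simp⟩
    have hxB : x ∈ closure B \ (U \ {x}) := hBx.ge (mem_singleton x)
    refine ⟨B, hB, hxB.1, fun y hy => ?_⟩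
    by_contra hyU
    have hyx : y ∈ ({x} : Set X) := hBx.le ⟨hy, fun h => hyU h.1⟩
    exact hyU (mem_singleton_iff.1 hyx ▸ hx)
  · refine ⟨U \ closure (U \ {x}), hU.sdiff isClosed_closure, subset_closure ⟨hx, hcl⟩, ?_⟩
    have hsub : U \ closure (U \ {x}) ⊆ {x} := fun y hy => by
      by_contra hyx
      exact hy.2 (subset_closure ⟨hy.1, hyx⟩)
    exact (closure_minimal hsub isClosed_singleton).trans (singleton_subset_iff.2 hx)

/-- In a Hausdorff open Whyburn space, every point lies in a regular closed set meeting a given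
nowhere dense set in at most that point. -/
theorem OpenWhyburn.exists_isOpen_closure_inter_subset {X : Type*} [TopologicalSpace X]
    [T2Space X] (hw : OpenWhyburn X) {A : Set X} (hA : IsNowhereDense A) (x : X) :
    ∃ B : Set X, IsOpen B ∧ x ∈ closure B ∧ closure B ∩ A ⊆ {x} := by
  by_cases hx : x ∈ closure A
  · have hcl : x ∈ closure (closure A)ᶜ := by
      rw [closure_compl, hA]
      simp
    obtain ⟨B, hB, -, hBx⟩ := hw (closure A)ᶜ isClosed_closure.isOpen_compl x ⟨hcl, by simpa⟩
    have hxB : x ∈ closure B \ (closure A)ᶜ := hBx.ge (mem_singleton x)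
    exact ⟨B, hB, hxB.1, fun y hy => hBx.le ⟨hy.1, fun h => h (subset_closure hy.2)⟩⟩
  · obtain ⟨B, hB, hxB, hBU⟩ :=
      hw.exists_isOpen_closure_subset isClosed_closure.isOpen_compl (mem_compl hx)
    exact ⟨B, hB, hxB, fun y hy => absurd (subset_closure hy.2) (hBU hy.1)⟩

theorem qp_frechetUrysohn_nowhereDense_countable
    (X : Type*) [TopologicalSpace X] [T2Space X] (hsr : SemiRegular X)
    (hw : OpenWhyburn X) (hFU : FrechetUrysohnSpace (Qp X)) :
    ∀ A : Set X, IsNowhereDense A → A.Countable := by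
  intro A hA
  choose B hBo hxB hBA using hw.exists_isOpen_closure_inter_subset hA
  let h : Finset X → Qp X := fun K =>
    ⟨_, quasicontinuous_indicator_closure
      (isOpen_biUnion fun x (_ : x ∈ K) => hBo x)⟩
  let one : Qp X := ⟨_, quasicontinuous_indicator_closure (X := X) isOpen_univ⟩
  have one_apply (x : X) : one.1 x = 1 := by simp [one]
  have h_apply_mem {K : Finset X} {x : X} (hx : x ∈ K) : (h K).1 x = 1 :=
    indicator_of_mem (closure_mono (subset_biUnion_of_mem (u := B) hx) (hxB x)) _
  have h_support (K : Finset X) : {a ∈ A | (h K).1 a ≠ 0} ⊆ K := by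
    rintro a ⟨haA, ha⟩
    have hacl : a ∈ closure (⋃ x ∈ K, B x) := mem_of_indicator_ne_zero ha
    rw [K.closure_biUnion] at hacl
    obtain ⟨x, hxK, hax⟩ := mem_iUnion₂.1 hacl
    exact mem_singleton_iff.1 (hBA x ⟨hax, haA⟩) ▸ hxK
  have h_tendsto : Tendsto h atTop (𝓝 one) := by
    rw [tendsto_subtype_rng, tendsto_pi_nhds]
    intro x
    rw [one_apply]
    refine tendsto_const_nhds.congr' ?_
    filter_upwards [eventually_ge_atTop {x}] with K hK
    exact (h_apply_mem (hK (Finset.mem_singleton_self x))).symm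
  have h_closure : one ∈ closure (range h) :=
    mem_closure_of_tendsto h_tendsto (Eventually.of_forall mem_range_self)
  obtain ⟨u, hu, hlim⟩ := mem_closure_iff_seq_limit.1 h_closure
  choose K hK using hu
  refine (countable_iUnion fun n => (K n).countable_toSet).mono fun a ha => ?_
  have hlim_a : Tendsto (fun n => (u n).1 a) atTop (𝓝 1) := by
    rw [← one_apply a]
    exact tendsto_pi_nhds.1 (tendsto_subtype_rng.1 hlim) a
  obtain ⟨n, hn⟩ := (hlim_a.eventually_ne one_ne_zero).exists
  rw [← hK n] at hn
  exact mem_iUnion.2 ⟨n, h_support (K n) ⟨ha, hn⟩⟩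
end

section
/- Let X be a regular topological space with countable pseudocharacter that is k-Fréchet–Urysohn. Then X is open Whyburn. -/
open Set Filter Topology

theorem openWhyburn_of_kFrechetUrysohn
    (X : Type*) [TopologicalSpace X] [RegularSpace X]
    (hpsi : ∀ x : X, ∃ U : ℕ → Set X, (∀ n, IsOpen (U n) ∧ x ∈ U n) ∧ (⋂ n, U n) = {x})
    (hkFU : ∀ U : Set X, IsOpen U → ∀ x ∈ closure U,
      ∃ u : ℕ → X, (∀ n, u n ∈ U) ∧ Filter.Tendsto u Filter.atTop (nhds x)) :
    OpenWhyburn X := by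
  rintro A hA x ⟨hxA, hxnA⟩
  obtain ⟨a, haA, hax⟩ := hkFU A hA x hxA
  obtain ⟨U, hU, hUx⟩ := hpsi x
  have shrink (y : X) (V : Set X) (hV : V ∈ 𝓝 y) :
      ∃ W : Set X, IsOpen W ∧ y ∈ W ∧ closure W ⊆ V := by
    obtain ⟨T, hT, hTc, hTV⟩ := exists_mem_nhds_isClosed_subset hV
    exact ⟨interior T, isOpen_interior, mem_interior_iff_mem_nhds.2 hT,
      (closure_minimal interior_subset hTc).trans hTV⟩
  choose C hCo hxC hCU using fun k => shrink x (U k) ((hU k).1.mem_nhds (hU k).2)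
  have hV (n : ℕ) : A ∩ ⋂ k ∈ {k | k ≤ n ∧ a n ∈ C k}, C k ∈ 𝓝 (a n) := by
    refine inter_mem (hA.mem_nhds (haA n)) ((biInter_mem ?_).2 ?_)
    · exact (finite_Iic n).subset fun k hk => hk.1
    · exact fun k hk => (hCo k).mem_nhds hk.2
  choose B hBo haB hBV using fun n => shrink (a n) _ (hV n)
  have hBA (n : ℕ) : closure (B n) ⊆ A := (hBV n).trans inter_subset_left
  have hBC (n k : ℕ) (hkn : k ≤ n) (hak : a n ∈ C k) : B n ⊆ C k := fun y hy =>
    mem_iInter₂.1 (hBV n (subset_closure hy)).2 k ⟨hkn, hak⟩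
  refine ⟨⋃ n, B n, isOpen_iUnion hBo,
    iUnion_subset fun n => subset_closure.trans (hBA n), Subset.antisymm ?_ ?_⟩
  · rintro y ⟨hyB, hyA⟩
    rw [← hUx, mem_iInter]
    intro k
    obtain ⟨N, hN⟩ := eventually_atTop.1 (hax.eventually ((hCo k).mem_nhds (hxC k)))
    have hcover : ⋃ n, B n ⊆ (⋃ n ∈ Iio (max N k), B n) ∪ C k := by
      refine iUnion_subset fun n => ?_
      rcases lt_or_ge n (max N k) with hn | hn
      · exact (subset_biUnion_of_mem (u := B) (mem_Iio.2 hn)).trans subset_union_left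
      · exact (hBC n k ((le_max_right _ _).trans hn)
          (hN n ((le_max_left _ _).trans hn))).trans subset_union_right
    have hy := closure_mono hcover hyB
    rw [closure_union, (finite_Iio _).closure_biUnion] at hy
    rcases hy with hy | hy
    · obtain ⟨n, -, hn⟩ := mem_iUnion₂.1 hy
      exact absurd (hBA n hn) hyA
    · exact hCU k hy
  · rintro _ rfl
    exact ⟨mem_closure_of_tendsto hax (Eventually.of_forall fun n => mem_iUnion.2 ⟨n, haB n⟩),
      hxnA⟩
end

section
/- Let X be an uncountable first-countable regular Hausdorff semi-regular space such that the space Q_p(X,ℝ) of quasicontinuous real-valued functions on X with the topology of pointwise convergence is Fréchet–Urysohn. Then X is a Lusin space in the sense of Kunen: every nowhere dense subset of X is countable, X has at most countably many isolated points, and X is uncountable. -/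
open Set Filter Topology

open Classical in
/-- The indicator of the complement of the closure of an open set is quasicontinuous. -/
lemma quasicontinuous_indicator_compl_closure {X : Type*} [TopologicalSpace X] {G : Set X}
    (hG : IsOpen G) : Quasicontinuous (fun y => if y ∈ closure G then (0 : ℝ) else 1) := by
  intro x U hU hxU V _ hxV
  by_cases hx : x ∈ closure G
  · refine ⟨U ∩ G, hU.inter hG, mem_closure_iff.1 hx U hU hxU, inter_subset_left, ?_⟩
    rintro _ ⟨y, hy, rfl⟩
    simpa [hx, subset_closure hy.2] using hxV
  · refine ⟨U ∩ (closure G)ᶜ, hU.inter isClosed_closure.isOpen_compl, ⟨x, hxU, hx⟩,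
      inter_subset_left, ?_⟩
    rintro _ ⟨y, hy, rfl⟩
    have hy' : y ∉ closure G := hy.2
    simpa [hx, hy'] using hxV

/-- If every point lies in the closure of an open set whose closure meets `A` in a countable
set, and `Qp X` is Fréchet–Urysohn, then `A` is countable. -/
lemma countable_of_forall_exists_isOpen {X : Type*} [TopologicalSpace X]
    [FrechetUrysohnSpace (Qp X)] {A : Set X}
    (h : ∀ x : X, ∃ G : Set X, IsOpen G ∧ x ∈ closure G ∧ (closure G ∩ A).Countable) :
    A.Countable := by
  classical
  choose G hGo hxG hGA using h
  let B : Set (Qp X) := {f | {a ∈ A | f.1 a ≠ 1}.Countable}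
  let z : Qp X := ⟨fun _ => 0, fun x U hU hx V _ hV =>
    ⟨U, hU, ⟨x, hx⟩, subset_rfl, by rintro _ ⟨y, -, rfl⟩; exact hV⟩⟩
  have hz : z ∈ closure B := by
    rw [mem_closure_iff_nhds]
    intro t ht
    rw [nhds_induced, mem_comap] at ht
    obtain ⟨s, hs, hst⟩ := ht
    rw [nhds_pi, Filter.mem_pi] at hs
    obtain ⟨K, hK, v, hv, hvs⟩ := hs
    have hcl : closure (⋃ x ∈ K, G x) = ⋃ x ∈ K, closure (G x) := hK.closure_biUnion _
    refine ⟨⟨_, quasicontinuous_indicator_compl_closure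
      (isOpen_biUnion fun x (_ : x ∈ K) => hGo x)⟩, hst (hvs ?_), ?_⟩
    · intro x hx
      have : x ∈ closure (⋃ x ∈ K, G x) := hcl ▸ mem_biUnion hx (hxG x)
      simpa only [this, if_true] using mem_of_mem_nhds (hv x)
    · refine (hK.countable.biUnion fun x _ => hGA x).mono ?_
      rintro a ⟨haA, ha⟩
      have : a ∈ closure (⋃ x ∈ K, G x) := by
        by_contra hn
        exact ha (if_neg hn)
      rw [hcl] at this
      obtain ⟨x, hx, hax⟩ := mem_iUnion₂.1 this
      exact mem_biUnion hx ⟨hax, haA⟩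
  obtain ⟨u, huB, hu⟩ := mem_closure_iff_seq_limit.1 hz
  refine (countable_iUnion huB).mono fun a ha => ?_
  by_contra hn
  have hone : ∀ n, (u n).1 a = 1 := fun n => by
    by_contra h1
    exact hn (mem_iUnion.2 ⟨n, ha, h1⟩)
  have hlim : Tendsto (fun n => (u n).1 a) atTop (𝓝 (0 : ℝ)) :=
    ((continuous_apply a).comp continuous_subtype_val).continuousAt.tendsto.comp hu
  simp only [hone] at hlim
  exact one_ne_zero (tendsto_nhds_unique tendsto_const_nhds hlim)

lemma exists_isOpen_mem_closure_inter_isolated_countable {X : Type*} [TopologicalSpace X]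
    [FrechetUrysohnSpace X] (x : X) :
    ∃ G : Set X, IsOpen G ∧ x ∈ closure G ∧
      (closure G ∩ {y : X | IsOpen ({y} : Set X)}).Countable := by
  set I := {y : X | IsOpen ({y} : Set X)}
  have hIo : ∀ S ⊆ I, IsOpen S := fun S hS => by
    rw [← biUnion_of_singleton S]
    exact isOpen_biUnion fun y hy => hS hy
  by_cases hx : x ∈ closure I
  · obtain ⟨u, huI, hu⟩ := mem_closure_iff_seq_limit.1 hx
    refine ⟨range u, hIo _ (range_subset_iff.2 huI),
      mem_closure_of_tendsto hu (.of_forall mem_range_self), (countable_range u).mono ?_⟩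
    rintro y ⟨hy, hyI⟩
    obtain ⟨w, rfl, hw⟩ := mem_closure_iff.1 hy {y} hyI rfl
    exact hw
  · refine ⟨(closure I)ᶜ, isClosed_closure.isOpen_compl, subset_closure hx, ?_⟩
    convert countable_empty
    rw [← disjoint_iff_inter_eq_empty]
    exact (disjoint_compl_left.mono_right subset_closure).closure_left (hIo I subset_rfl)

lemma IsNowhereDense.exists_isOpen_mem_closure_inter_subset {X : Type*} [TopologicalSpace X]
    [T2Space X] [RegularSpace X] [FirstCountableTopology X] {A : Set X}
    (hA : IsNowhereDense A) (x : X) :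
    ∃ G : Set X, IsOpen G ∧ x ∈ closure G ∧ closure G ∩ A ⊆ {x} := by
  obtain ⟨U, hU⟩ := (𝓝 x).exists_antitone_basis
  have hW : ∀ n, ∃ W : Set X, IsOpen W ∧ W.Nonempty ∧ closure W ⊆ U n \ closure A := by
    intro n
    have hd : Dense (closure A)ᶜ := interior_eq_empty_iff_dense_compl.1 hA
    obtain ⟨p, hpU, hpA⟩ := hd.inter_open_nonempty (interior (U n)) isOpen_interior
      ⟨x, mem_interior_iff_mem_nhds.2 (hU.mem n)⟩
    have hp : U n \ closure A ∈ 𝓝 p := inter_mem (mem_interior_iff_mem_nhds.1 hpU)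
      (isClosed_closure.isOpen_compl.mem_nhds hpA)
    obtain ⟨t, ht, htc, hts⟩ := exists_mem_nhds_isClosed_subset hp
    exact ⟨interior t, isOpen_interior, ⟨p, mem_interior_iff_mem_nhds.2 ht⟩,
      (closure_minimal interior_subset htc).trans hts⟩
  choose W hWo hWne hWsub using hW
  refine ⟨⋃ n, W n, isOpen_iUnion hWo, ?_, ?_⟩
  · rw [mem_closure_iff_nhds]
    intro t ht
    obtain ⟨n, hn⟩ := hU.mem_iff.1 ht
    obtain ⟨p, hp⟩ := hWne n
    exact ⟨p, hn (hWsub n (subset_closure hp)).1, mem_iUnion.2 ⟨n, hp⟩⟩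
  · rintro y ⟨hy, hyA⟩
    by_contra hne
    obtain ⟨V, O, hV, hO, hyV, hxO, hVO⟩ := t2_separation (show y ≠ x from hne)
    obtain ⟨N, hN⟩ := hU.mem_iff.1 (hO.mem_nhds hxO)
    have hfin : y ∈ closure (⋃ n ∈ Iio N, W n) := by
      rw [mem_closure_iff]
      intro T hT hyT
      obtain ⟨w, ⟨hwT, hwV⟩, hw⟩ := mem_closure_iff.1 hy (T ∩ V) (hT.inter hV) ⟨hyT, hyV⟩
      obtain ⟨n, hn⟩ := mem_iUnion.1 hw
      refine ⟨w, hwT, mem_biUnion (show n < N from ?_) hn⟩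
      by_contra hle
      exact disjoint_left.1 hVO hwV
        (hN (hU.antitone (not_lt.1 hle) (hWsub n (subset_closure hn)).1))
    rw [(finite_Iio N).closure_biUnion] at hfin
    obtain ⟨n, -, hn⟩ := mem_iUnion₂.1 hfin
    exact (hWsub n hn).2 (subset_closure hyA)

theorem qp_frechetUrysohn_firstCountable_lusin
    (X : Type*) [TopologicalSpace X] [T2Space X] [RegularSpace X]
    [FirstCountableTopology X] (hsr : SemiRegular X) [Uncountable X]
    (hFU : FrechetUrysohnSpace (Qp X)) :
    (∀ A : Set X, IsNowhereDense A → A.Countable) ∧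
      ({x : X | IsOpen ({x} : Set X)}).Countable ∧ Uncountable X := by
  refine ⟨fun A hA => countable_of_forall_exists_isOpen fun x => ?_,
    countable_of_forall_exists_isOpen exists_isOpen_mem_closure_inter_isolated_countable, ‹_›⟩
  obtain ⟨G, hG, hx, hGA⟩ := hA.exists_isOpen_mem_closure_inter_subset x
  exact ⟨G, hG, hx, (countable_singleton x).mono hGA⟩
end

section
/- Let X be a Hausdorff semi-regular open Whyburn space whose cardinality is strictly greater than the cardinality of the continuum 2^ℵ₀. Then the space Q_p(X,ℝ) of quasicontinuous real-valued functions on X with the topology of pointwise convergence is not Fréchet–Urysohn. -/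
open Set Filter Topology

/-! ### Minimally bounded sets and quasicontinuous indicators -/

theorem MinimallyBounded.of_interior_closure_subset {X : Type*} [TopologicalSpace X]
    {O Z : Set X} (hO : IsOpen O) (hOZ : O ⊆ Z) (hZ : Z ⊆ closure O)
    (h : interior (closure O) ⊆ Z) : MinimallyBounded Z :=
  ⟨hZ.trans (closure_mono (interior_maximal hOZ hO)),
    (interior_mono (closure_minimal hZ isClosed_closure)).trans h⟩

theorem IsOpen.minimallyBounded_closure {X : Type*} [TopologicalSpace X] {O : Set X}
    (hO : IsOpen O) : MinimallyBounded (closure O) :=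
  .of_interior_closure_subset hO subset_closure Subset.rfl interior_subset

theorem MinimallyBounded.quasicontinuous_indicator_s8 {X : Type*} [TopologicalSpace X]
    {Z : Set X} (hZ : MinimallyBounded Z) :
    Quasicontinuous (Z.indicator (fun _ => (1 : ℝ))) := by
  intro x U hU hxU V _ hxV
  by_cases hx : x ∈ Z
  · refine ⟨U ∩ interior Z, hU.inter isOpen_interior,
      mem_closure_iff.1 (hZ.1 hx) U hU hxU, inter_subset_left, ?_⟩
    rintro _ ⟨y, ⟨-, hy⟩, rfl⟩
    rw [indicator_of_mem hx] at hxV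
    rwa [indicator_of_mem (interior_subset hy)]
  · refine ⟨U \ closure Z, hU.sdiff isClosed_closure, ?_, sdiff_subset, ?_⟩
    · rw [nonempty_iff_ne_empty, Ne, sdiff_eq_empty]
      exact fun h => hx (hZ.2 (interior_maximal h hU hxU))
    · rintro _ ⟨y, ⟨-, hy⟩, rfl⟩
      rw [indicator_of_notMem hx] at hxV
      rwa [indicator_of_notMem fun h => hy (subset_closure h)]

/-- If finitely many points at a time cannot distinguish `Z` from the family `s`, then in the
Fréchet–Urysohn case some sequence of members of `s` converges pointwise to `Z`. -/
theorem exists_seq_eventually_mem_iff {X : Type*} [TopologicalSpace X]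
    [FrechetUrysohnSpace (Qp X)] {ι : Type*} (s : ι → Set X) {Z : Set X}
    (hs : ∀ i, MinimallyBounded (s i)) (hZ : MinimallyBounded Z)
    (h : ∀ F : Finset X, ∃ i, ∀ x ∈ F, (x ∈ s i ↔ x ∈ Z)) :
    ∃ u : ℕ → ι, ∀ x, ∀ᶠ n in atTop, (x ∈ s (u n) ↔ x ∈ Z) := by
  set f : ι → Qp X := fun i => ⟨_, (hs i).quasicontinuous_indicator_s8⟩ with hf
  set g : Qp X := ⟨_, hZ.quasicontinuous_indicator_s8⟩ with hg
  have hcl : g ∈ closure (range f) := by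
    rw [closure_subtype, mem_closure_iff_nhds]
    intro t ht
    rw [nhds_pi, Filter.mem_pi'] at ht
    obtain ⟨F, v, hv, hvt⟩ := ht
    obtain ⟨i, hi⟩ := h F
    refine ⟨f i, hvt fun x hx => ?_, f i, mem_range_self i, rfl⟩
    have : (f i : X → ℝ) x = (g : X → ℝ) x := by
      by_cases hxZ : x ∈ Z <;> simp [hf, hg, hi x hx, hxZ]
    rw [this]
    exact mem_of_mem_nhds (hv x)
  obtain ⟨w, hw, hlim⟩ := mem_closure_iff_seq_limit.1 hcl
  choose u hu using hw
  refine ⟨u, fun x => ?_⟩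
  have hx : Tendsto (fun n => (w n : X → ℝ) x) atTop (𝓝 ((g : X → ℝ) x)) :=
    (((continuous_apply x).comp continuous_subtype_val).tendsto g).comp hlim
  have hball := hx (Metric.ball_mem_nhds _ one_pos)
  filter_upwards [hball] with n hn
  rw [mem_preimage, ← hu n] at hn
  by_cases h1 : x ∈ s (u n) <;> by_cases h2 : x ∈ Z <;> simp [hf, hg, h1, h2] at hn ⊢

/-! ### The countable chain condition -/

theorem countable_of_interior_closure_subset {X : Type*} [TopologicalSpace X]
    [FrechetUrysohnSpace (Qp X)] {ι : Type*} (V : ι → Set X) (hVo : ∀ i, IsOpen (V i))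
    (hVn : ∀ i, (V i).Nonempty) (hVd : Pairwise (Function.onFun Disjoint V))
    (h : ∀ x ∈ interior (closure (⋃ i, V i)),
      ∃ J : Set ι, J.Countable ∧ x ∈ closure (⋃ i ∈ J, V i)) :
    Countable ι := by
  set Z : Set X := {x | ∃ J : Set ι, J.Countable ∧ x ∈ closure (⋃ i ∈ J, V i)}
  have hVZ (i : ι) : V i ⊆ Z := fun x hx =>
    ⟨{i}, countable_singleton i, subset_closure (by simpa using hx)⟩
  have hZb : MinimallyBounded Z := by
    refine .of_interior_closure_subset (isOpen_iUnion hVo) (iUnion_subset hVZ) ?_ h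
    rintro x ⟨J, -, hx⟩
    exact closure_mono (iUnion₂_subset_iUnion _ _) hx
  obtain ⟨u, hu⟩ := exists_seq_eventually_mem_iff
    (fun J : {J : Set ι // J.Countable} => closure (⋃ i ∈ J.1, V i))
    (fun J => (isOpen_biUnion fun i _ => hVo i).minimallyBounded_closure) hZb (by
      intro F
      have hJ (x : X) : ∃ J : Set ι, J.Countable ∧
          (x ∈ Z → x ∈ closure (⋃ i ∈ J, V i)) := by
        by_cases hx : x ∈ Z
        · obtain ⟨J, hJ, hxJ⟩ := hx
          exact ⟨J, hJ, fun _ => hxJ⟩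
        · exact ⟨∅, countable_empty, fun h => absurd h hx⟩
      choose J hJc hJ using hJ
      refine ⟨⟨⋃ x ∈ F, J x, F.countable_toSet.biUnion fun x _ => hJc x⟩, fun x hx => ?_⟩
      refine ⟨fun h => ⟨_, F.countable_toSet.biUnion fun x _ => hJc x, h⟩, fun h => ?_⟩
      exact closure_mono (biUnion_subset_biUnion_left
        (subset_biUnion_of_mem (u := J) (Finset.mem_coe.2 hx))) (hJ x h))
  have huniv : (⋃ n, (u n).1) = univ := by
    refine eq_univ_of_forall fun i => ?_
    obtain ⟨x, hx⟩ := hVn i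
    obtain ⟨n, hn⟩ := (hu x).exists
    obtain ⟨y, hy, hyJ⟩ := mem_closure_iff.1 (hn.2 (hVZ i hx)) _ (hVo i) hx
    obtain ⟨j, hj, hyj⟩ := mem_iUnion₂.1 hyJ
    obtain rfl : i = j := by
      by_contra hij
      exact disjoint_left.1 (hVd hij) hy hyj
    exact mem_iUnion.2 ⟨n, hj⟩
  rw [← countable_univ_iff, ← huniv]
  exact countable_iUnion fun n => (u n).2

/-- If `Qp X` is Fréchet–Urysohn and `X` is open Whyburn, then `X` is ccc. -/
theorem OpenWhyburn.countable_of_pairwise_disjoint {X : Type*} [TopologicalSpace X]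
    [FrechetUrysohnSpace (Qp X)] (hw : OpenWhyburn X) {ι : Type*} (V : ι → Set X)
    (hVo : ∀ i, IsOpen (V i)) (hVn : ∀ i, (V i).Nonempty)
    (hVd : Pairwise (Function.onFun Disjoint V)) : Countable ι := by
  by_cases hcl : ∀ x ∈ closure (⋃ i, V i),
      ∃ J : Set ι, J.Countable ∧ x ∈ closure (⋃ i ∈ J, V i)
  · exact countable_of_interior_closure_subset V hVo hVn hVd
      fun x hx => hcl x (interior_subset hx)
  exfalso
  push Not at hcl
  obtain ⟨x, hx, hxJ⟩ := hcl
  have hxA : x ∉ ⋃ i, V i := fun h => by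
    obtain ⟨i, hi⟩ := mem_iUnion.1 h
    exact hxJ {i} (countable_singleton i) (subset_closure (by simpa using hi))
  obtain ⟨B, hBo, hBA, hB⟩ := hw _ (isOpen_iUnion hVo) x ⟨hx, hxA⟩
  have hxB : x ∈ closure B := (hB.symm ▸ mem_singleton x : x ∈ closure B \ ⋃ i, V i).1
  set I : Set ι := {i | (B ∩ V i).Nonempty}
  have hIc : ¬ I.Countable := fun hc => by
    refine hxJ I hc (closure_mono (fun y hy => ?_) hxB)
    obtain ⟨i, hi⟩ := mem_iUnion.1 (hBA hy)
    exact mem_biUnion (show i ∈ I from ⟨y, hy, hi⟩) hi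
  have hI_inf : Infinite I := by
    rw [← not_finite_iff_infinite]
    exact fun h => hIc (Set.toFinite I).countable
  obtain ⟨e⟩ : Nonempty (I ⊕ I ≃ I) :=
    Cardinal.eq.1 (by simp)
  have key (φ : I → I) (hφ : Function.Injective φ) :
      x ∈ interior (closure (⋃ i, B ∩ V (φ i))) := by
    by_contra hxi
    refine hIc (countable_of_interior_closure_subset (fun i => B ∩ V (φ i))
      (fun i => hBo.inter (hVo _)) (fun i => (φ i).2) (fun i j hij =>
        (hVd fun h => hij (hφ (Subtype.ext h))).mono inter_subset_right inter_subset_right)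
      fun y hy => ?_)
    have hyc := interior_subset hy
    have hyA : y ∈ ⋃ i, V i := by
      by_contra hyA
      have : y ∈ closure B \ ⋃ i, V i :=
        ⟨closure_mono (iUnion_subset fun i => inter_subset_left) hyc, hyA⟩
      rw [hB] at this
      exact hxi (this ▸ hy)
    obtain ⟨k, hk⟩ := mem_iUnion.1 hyA
    refine ⟨{i | (φ i : ι) = k}, Set.Subsingleton.countable fun i hi j hj =>
      hφ (Subtype.ext (hi.trans hj.symm)), mem_closure_iff.2 fun O hO hyO => ?_⟩
    obtain ⟨z, ⟨hzO, hzk⟩, hz⟩ := mem_closure_iff.1 hyc _ (hO.inter (hVo k)) ⟨hyO, hk⟩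
    obtain ⟨i, hi⟩ := mem_iUnion.1 hz
    refine ⟨z, hzO, mem_biUnion (?_ : (φ i : ι) = k) hi⟩
    by_contra hne
    exact disjoint_left.1 (hVd hne) hi.2 hzk
  have hd : Disjoint (⋃ i, B ∩ V (e (.inl i))) (⋃ i, B ∩ V (e (.inr i))) := by
    simp only [disjoint_iUnion_left, disjoint_iUnion_right]
    refine fun i j => (hVd fun h => ?_).mono inter_subset_right inter_subset_right
    simpa using e.injective (Subtype.ext h)
  have hd' := ((hd.closure_left (isOpen_iUnion fun i => hBo.inter (hVo _))).mono_left
    interior_subset).closure_right isOpen_interior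
  exact disjoint_left.1 hd' (key _ (e.injective.comp Sum.inl_injective))
    (interior_subset (key _ (e.injective.comp Sum.inr_injective)))

/-! ### Closed sets with empty interior are countable -/

theorem OpenWhyburn.exists_isOpen_mem_closure_subset {X : Type*} [TopologicalSpace X]
    [T1Space X] (hw : OpenWhyburn X) {U : Set X} (hU : IsOpen U) {x : X}
    (hx : x ∈ closure U) : ∃ B, IsOpen B ∧ x ∈ closure B ∧ closure B ⊆ insert x U := by
  by_cases hxc : x ∈ closure (U \ {x})
  · obtain ⟨B, hBo, -, hB⟩ := hw (U \ {x}) (hU.sdiff isClosed_singleton) x ⟨hxc, by simp⟩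
    refine ⟨B, hBo, (hB.symm ▸ mem_singleton x : x ∈ closure B \ (U \ {x})).1,
      fun y hy => ?_⟩
    by_cases hyU : y ∈ U \ {x}
    · exact Or.inr hyU.1
    · exact Or.inl (hB ▸ (⟨hy, hyU⟩ : y ∈ closure B \ (U \ {x})) : y ∈ ({x} : Set X))
  · obtain ⟨O, hO, hxO, hOU⟩ : ∃ O, IsOpen O ∧ x ∈ O ∧ O ∩ (U \ {x}) = ∅ := by
      simpa [mem_closure_iff, not_nonempty_iff_eq_empty] using hxc
    have hsub : O ∩ U ⊆ {x} := fun y hy => by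
      by_contra hyx
      exact (hOU ▸ (⟨hy.1, hy.2, hyx⟩ : y ∈ O ∩ (U \ {x})) : y ∈ (∅ : Set X))
    refine ⟨O ∩ U, hO.inter hU, hO.inter_closure ⟨hxO, hx⟩,
      (closure_minimal hsub isClosed_singleton).trans (by simp)⟩

theorem OpenWhyburn.countable_of_interior_eq_empty {X : Type*} [TopologicalSpace X]
    [T1Space X] [FrechetUrysohnSpace (Qp X)] (hw : OpenWhyburn X) {N : Set X}
    (hN : IsClosed N) (hNi : interior N = ∅) : N.Countable := by
  have hd : Dense Nᶜ := interior_eq_empty_iff_dense_compl.1 hNi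
  choose B hBo hxB hBN using fun x =>
    hw.exists_isOpen_mem_closure_subset hN.isOpen_compl (hd x)
  have hcl (F : Finset X) : closure (⋃ x ∈ F, B x) = ⋃ x ∈ F, closure (B x) :=
    F.finite_toSet.closure_biUnion B
  obtain ⟨u, hu⟩ := exists_seq_eventually_mem_iff (Z := univ)
    (fun F : Finset X => closure (⋃ x ∈ F, B x))
    (fun F => (isOpen_biUnion fun x _ => hBo x).minimallyBounded_closure)
    (by simp [MinimallyBounded]) (fun F => ⟨F, fun x hx => by
      simp only [mem_univ, iff_true, hcl]
      exact mem_biUnion hx (hxB x)⟩)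
  refine (countable_iUnion fun n => (u n).countable_toSet).mono fun x hx => ?_
  obtain ⟨n, hn⟩ := (hu x).exists
  have hxn := hn.2 (mem_univ x)
  simp only [hcl] at hxn
  obtain ⟨y, hy, hxy⟩ := mem_iUnion₂.1 hxn
  obtain rfl : x = y := (hBN y hxy).resolve_right fun h => h hx
  exact mem_iUnion.2 ⟨n, hy⟩

/-! ### Hereditary Lindelöfness -/

theorem OpenWhyburn.exists_countable_biUnion_eq {X : Type*} [TopologicalSpace X]
    [T1Space X] [FrechetUrysohnSpace (Qp X)] (hw : OpenWhyburn X) {ι : Type*}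
    (O : ι → Set X) (hO : ∀ i, IsOpen (O i)) :
    ∃ t : Set ι, t.Countable ∧ ⋃ i, O i ⊆ ⋃ i ∈ t, O i := by
  set V : ι → Set X := fun i => O i \ closure (⋃ j, ⋃ _ : WellOrderingRel j i, O j)
  have hVd {i j : ι} (hij : WellOrderingRel i j) : Disjoint (V i) (V j) :=
    disjoint_left.2 fun x hx hxj => hxj.2 (subset_closure (mem_iUnion₂.2 ⟨i, hij, hx.1⟩))
  set J : Set ι := {i | (V i).Nonempty}
  have hJc : J.Countable := hw.countable_of_pairwise_disjoint (fun i : J => V i)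
    (fun i => (hO i).sdiff isClosed_closure) (fun i => i.2) (fun i j hij => by
      rcases trichotomous_of WellOrderingRel (i : ι) (j : ι) with h | h | h
      · exact hVd h
      · exact absurd (Subtype.ext h) hij
      · exact (hVd h).symm)
  set G : Set X := ⋃ i ∈ J, O i
  have hGo : IsOpen G := isOpen_biUnion fun i _ => hO i
  have hdense : ⋃ i, O i ⊆ closure G := by
    intro x hx
    refine mem_closure_iff.2 fun W hW hxW => ?_
    obtain ⟨i₀, hi₀⟩ := mem_iUnion.1 hx
    obtain ⟨i, ⟨y, hyW, hyi⟩, hmin⟩ := WellOrderingRel.isWellOrder.wf.has_min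
      {i | (W ∩ O i).Nonempty} ⟨i₀, x, hxW, hi₀⟩
    have hyV : y ∈ V i := by
      refine ⟨hyi, fun hyc => ?_⟩
      obtain ⟨z, hzW, hz⟩ := mem_closure_iff.1 hyc W hW hyW
      obtain ⟨j, hj, hzj⟩ := mem_iUnion₂.1 hz
      exact hmin j ⟨z, hzW, hzj⟩ hj
    exact ⟨y, hyW, mem_biUnion (show i ∈ J from ⟨y, hyV⟩) hyi⟩
  have hNc : (closure G \ G).Countable := by
    refine hw.countable_of_interior_eq_empty (isClosed_closure.sdiff hGo) ?_
    refine eq_empty_of_forall_notMem fun x hx => ?_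
    obtain ⟨y, hy, hyG⟩ := mem_closure_iff.1 (interior_subset hx).1 _ isOpen_interior hx
    exact (interior_subset hy).2 hyG
  have hchoice (x : X) : ∃ s : Set ι, s.Countable ∧ (x ∈ ⋃ i, O i → x ∈ ⋃ i ∈ s, O i) := by
    by_cases hx : x ∈ ⋃ i, O i
    · obtain ⟨i, hi⟩ := mem_iUnion.1 hx
      exact ⟨{i}, countable_singleton i, fun _ => by simpa using hi⟩
    · exact ⟨∅, countable_empty, fun h => absurd h hx⟩
  choose s hsc hs using hchoice
  refine ⟨J ∪ ⋃ x ∈ closure G \ G, s x, hJc.union (hNc.biUnion fun x _ => hsc x),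
    fun x hx => ?_⟩
  rw [biUnion_union]
  by_cases hxG : x ∈ G
  · exact Or.inl hxG
  · exact Or.inr (biUnion_subset_biUnion_left
      (subset_biUnion_of_mem (u := s) (⟨hdense hx, hxG⟩ : x ∈ closure G \ G)) (hs x hx))

theorem OpenWhyburn.hereditarilyLindelofSpace {X : Type*} [TopologicalSpace X]
    [T1Space X] [FrechetUrysohnSpace (Qp X)] (hw : OpenWhyburn X) :
    HereditarilyLindelofSpace X where
  isHereditarilyLindelof_univ s _ := isLindelof_of_countable_subcover fun U hUo hsU => by
    obtain ⟨t, ht, hU⟩ := hw.exists_countable_biUnion_eq U hUo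
    exact ⟨t, ht, hsU.trans hU⟩

/-! ### Cardinality of hereditarily Lindelöf Hausdorff spaces -/

theorem exists_seq_isOpen_separating {X : Type*} [TopologicalSpace X] [T2Space X]
    [HereditarilyLindelofSpace X] (p : X) :
    ∃ V : ℕ → Set X, (∀ n, IsOpen (V n)) ∧ (∀ n, p ∈ V n) ∧ ∀ q, q ≠ p → ∃ n, q ∉ V n := by
  choose U O hU hO hqU hpO hd using fun q : {q : X // q ≠ p} => t2_separation q.2
  obtain ⟨t, ht, htU⟩ := eq_open_union_countable U hU
  have hcov (q : X) (hq : q ≠ p) : ∃ r ∈ t, q ∉ O r := by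
    have : q ∈ ⋃ r ∈ t, U r := htU ▸ mem_iUnion.2 ⟨⟨q, hq⟩, hqU ⟨q, hq⟩⟩
    obtain ⟨r, hr, hqr⟩ := mem_iUnion₂.1 this
    exact ⟨r, hr, disjoint_left.1 (hd r) hqr⟩
  rcases t.eq_empty_or_nonempty with rfl | hne
  · refine ⟨fun _ => univ, by simp, by simp, fun q hq => ?_⟩
    obtain ⟨r, hr, -⟩ := hcov q hq
    exact absurd hr (notMem_empty r)
  · obtain ⟨u, rfl⟩ := ht.exists_eq_range hne
    refine ⟨fun n => O (u n), fun n => hO _, fun n => hpO _, fun q hq => ?_⟩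
    obtain ⟨_, ⟨n, rfl⟩, hn⟩ := hcov q hq
    exact ⟨n, hn⟩

/-- A set of size at most continuum closed under a given map that takes sequences of points,
together with sequences of natural numbers, to points. -/
theorem exists_closed_mk_le_continuum {X : Type*} (x₀ : X)
    (step : (ℕ → ℕ) → (ℕ → X) → X) :
    ∃ A : Set X, Cardinal.mk A ≤ Cardinal.continuum ∧ x₀ ∈ A ∧
      ∀ a s, (∀ n, s n ∈ A) → step a s ∈ A := by
  let β : Option (ℕ → ℕ) → Type := fun o => o.elim Empty fun _ => ℕ
  let ev : WType β → X := WType.elim X fun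
    | ⟨none, _⟩ => x₀
    | ⟨some a, s⟩ => step a s
  refine ⟨range ev, ?_, ⟨.mk none Empty.elim, rfl⟩, fun a s hs => ?_⟩
  · have hW : Cardinal.mk (WType β) ≤ Cardinal.continuum := by
      refine WType.cardinalMk_le_of_le ((Cardinal.sum_le_mk_mul_iSup _).trans ?_)
      have hopt : Cardinal.mk (Option (ℕ → ℕ)) = Cardinal.continuum := by
        simp [Cardinal.add_one_eq Cardinal.aleph0_le_continuum]
      rw [hopt]
      refine (mul_le_mul_right (ciSup_le' fun o => ?_) _).trans
        Cardinal.continuum_mul_self.le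
      cases o with
      | none =>
        simpa [β] using Cardinal.one_le_aleph0.trans Cardinal.aleph0_le_continuum
      | some a => simp [β]
    have h := (Cardinal.mk_range_le_lift (f := ev)).trans (Cardinal.lift_le.2 hW)
    simpa using h
  · choose w hw using hs
    refine ⟨.mk (some a) w, ?_⟩
    change step a (fun n => ev (w n)) = step a s
    simp only [hw]

/-- **De Groot's inequality**, countable case. -/
theorem mk_le_continuum_of_hereditarilyLindelof (X : Type*) [TopologicalSpace X] [T2Space X]
    [HereditarilyLindelofSpace X] : Cardinal.mk X ≤ Cardinal.continuum := by
  classical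
  rcases isEmpty_or_nonempty X with _ | ⟨⟨x₀⟩⟩
  · simp
  choose V hVo hVp hV using exists_seq_isOpen_separating (X := X)
  obtain ⟨A, hAc, hx₀, hA⟩ := exists_closed_mk_le_continuum x₀ fun a s =>
    if h : ∃ y, ∀ n, y ∉ V (s n) (a n) then h.choose else x₀
  suffices A = univ by rwa [this, Cardinal.mk_univ] at hAc
  refine eq_univ_of_forall fun x => ?_
  by_contra hx
  choose m hm using fun p : A => hV p x fun h => hx (h ▸ p.2)
  obtain ⟨t, ht, htV⟩ := eq_open_union_countable (fun p : A => V p (m p)) fun p => hVo _ _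
  have hcov (y : A) : ∃ p ∈ t, (y : X) ∈ V p (m p) := by
    have : (y : X) ∈ ⋃ p ∈ t, V p (m p) := htV ▸ mem_iUnion.2 ⟨y, hVp _ _⟩
    simpa using this
  obtain ⟨p₀, hp₀, -⟩ := hcov ⟨x₀, hx₀⟩
  obtain ⟨u, rfl⟩ := ht.exists_eq_range ⟨p₀, hp₀⟩
  have hex : ∃ y, ∀ n, y ∉ V (u n) (m (u n)) := ⟨x, fun n => hm (u n)⟩
  have hy := hA (fun n => m (u n)) (fun n => u n) fun n => (u n).2
  rw [dif_pos hex] at hy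
  obtain ⟨_, ⟨n, rfl⟩, hn⟩ := hcov ⟨_, hy⟩
  exact hex.choose_spec n hn

theorem qp_not_frechetUrysohn_of_card_gt_continuum
    (X : Type*) [TopologicalSpace X] [T2Space X] (hsr : SemiRegular X)
    (hw : OpenWhyburn X) (hcard : Cardinal.continuum < Cardinal.mk X) :
    ¬ FrechetUrysohnSpace (Qp X) := by
  intro _
  have := hw.hereditarilyLindelofSpace
  exact hcard.not_ge (mk_le_continuum_of_hereditarilyLindelof X)
end

section
/- Let X be a metrizable topological space. Then the space Q_p(X,ℝ) of quasicontinuous real-valued functions on X with the topology of pointwise convergence is Fréchet–Urysohn if and only if X is countable. -/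
open Set Filter Topology

namespace Quasicontinuous

variable {X : Type*}

/-- The condition for quasicontinuity follows from continuity at a single point `y` of `U`
at which `f` takes a value in `V`. -/
theorem exists_isOpen_of_continuousAt [TopologicalSpace X] {f : X → ℝ} {y : X} {U : Set X}
    {V : Set ℝ} (hf : ContinuousAt f y) (hU : IsOpen U) (hy : y ∈ U) (hV : IsOpen V)
    (hfy : f y ∈ V) : ∃ W : Set X, IsOpen W ∧ W.Nonempty ∧ W ⊆ U ∧ f '' W ⊆ V := by
  refine ⟨U ∩ interior (f ⁻¹' V), hU.inter isOpen_interior,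
    ⟨y, hy, mem_interior_iff_mem_nhds.2 (hf (hV.mem_nhds hfy))⟩, inter_subset_left, ?_⟩
  rintro _ ⟨z, hz, rfl⟩
  exact interior_subset (s := f ⁻¹' V) hz.2

theorem of_continuous [TopologicalSpace X] {f : X → ℝ} (hf : Continuous f) :
    Quasicontinuous f :=
  fun _ _ hU hx _ hV hfx ↦ exists_isOpen_of_continuousAt hf.continuousAt hU hx hV hfx

/-- A Urysohn-type function for closed sets `Y` and `N` that may meet, as long as the common points
can be approximated from `Y \ N`. On `Y ∩ N` the value is `0 / 0 = 0`. -/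
theorem infDist_div [MetricSpace X] {Y N : Set X} (hY : IsClosed Y) (hN : IsClosed N)
    (hY₀ : Y.Nonempty) (hN₀ : N.Nonempty) (h : Y ∩ N ⊆ closure (Y \ N)) :
    Quasicontinuous fun z ↦
      Metric.infDist z Y / (Metric.infDist z Y + Metric.infDist z N) := by
  have hcont : ∀ z, Metric.infDist z Y + Metric.infDist z N ≠ 0 → ContinuousAt (fun z ↦
      Metric.infDist z Y / (Metric.infDist z Y + Metric.infDist z N)) z := fun z hz ↦
    (Metric.continuous_infDist_pt Y).continuousAt.div
      ((Metric.continuous_infDist_pt Y).add (Metric.continuous_infDist_pt N)).continuousAt hz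
  intro x U hU hx V hV hfx
  by_cases h₀ : Metric.infDist x Y + Metric.infDist x N = 0
  · have hxY : Metric.infDist x Y = 0 := by
      linarith [Metric.infDist_nonneg (x := x) (s := Y), Metric.infDist_nonneg (x := x) (s := N)]
    have hxN : Metric.infDist x N = 0 := by linarith
    obtain ⟨y, hyU, hyY, hyN⟩ := mem_closure_iff.1
      (h ⟨(hY.mem_iff_infDist_zero hY₀).2 hxY, (hN.mem_iff_infDist_zero hN₀).2 hxN⟩) U hU hx
    have hy : Metric.infDist y Y = 0 := (hY.mem_iff_infDist_zero hY₀).1 hyY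
    have hy' : Metric.infDist y N ≠ 0 := fun h' ↦ hyN ((hN.mem_iff_infDist_zero hN₀).2 h')
    refine exists_isOpen_of_continuousAt (hcont y (by simpa [hy] using hy')) hU hyU hV ?_
    simpa [hy, hxY] using hfx
  · exact exists_isOpen_of_continuousAt (hcont x h₀) hU hx hV hfx

end Quasicontinuous

namespace Qp

variable {X : Type*}

theorem frechetUrysohnSpace_of_countable [TopologicalSpace X] [Countable X] :
    FrechetUrysohnSpace (Qp X) :=
  inferInstance

theorem exists_seq_tendsto_zero [TopologicalSpace X] [FrechetUrysohnSpace (Qp X)]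
    {A : Set (X → ℝ)} (hA : ∀ F : Finset X, ∃ f ∈ A, Quasicontinuous f ∧ ∀ x ∈ F, f x = 0) :
    ∃ g : ℕ → X → ℝ, (∀ n, g n ∈ A) ∧ ∀ x, Tendsto (fun n ↦ g n x) atTop (𝓝 0) := by
  have h₀ : (⟨fun _ ↦ 0, .of_continuous continuous_const⟩ : Qp X) ∈
      closure {f : Qp X | (f : X → ℝ) ∈ A} := by
    rw [mem_closure_iff_nhds]
    intro t ht
    obtain ⟨u, hu, hut⟩ := (mem_nhds_induced _ _ _).1 ht
    rw [nhds_pi, Filter.mem_pi'] at hu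
    obtain ⟨F, v, hv, hvu⟩ := hu
    obtain ⟨f, hfA, hf, hfF⟩ := hA F
    refine ⟨⟨f, hf⟩, hut (hvu fun x hx ↦ ?_), hfA⟩
    change f x ∈ v x
    rw [hfF x hx]
    exact mem_of_mem_nhds (hv x)
  obtain ⟨g, hgA, hg⟩ := mem_closure_iff_seq_limit.1 h₀
  refine ⟨fun n ↦ g n, hgA, fun x ↦ ?_⟩
  exact tendsto_pi_nhds.1 ((continuous_subtype_val.tendsto _).comp hg) x

theorem countable_of_separation [TopologicalSpace X] [FrechetUrysohnSpace (Qp X)] {S : Set X}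
    (hS : ∀ F : Finset X, ∃ f, Quasicontinuous f ∧ (∀ x ∈ F, f x = 0) ∧
      ∀ x ∈ S, x ∉ F → f x = 1) : S.Countable := by
  obtain ⟨g, hgA, hg⟩ := exists_seq_tendsto_zero (X := X)
    (A := {f | {x ∈ S | f x ≠ 1}.Finite}) fun F ↦ by
      obtain ⟨f, hf, hf₀, hf₁⟩ := hS F
      refine ⟨f, F.finite_toSet.subset fun x hx ↦ ?_, hf, hf₀⟩
      by_contra hxF
      exact hx.2 (hf₁ x hx.1 hxF)
  refine (countable_iUnion fun n ↦ (hgA n).countable).mono fun x hx ↦ ?_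
  obtain ⟨n, hn⟩ := ((hg x).eventually_ne zero_ne_one).exists
  exact mem_iUnion.2 ⟨n, hx, hn⟩

theorem countable_of_isClosed_of_interior_eq_empty [MetricSpace X] [FrechetUrysohnSpace (Qp X)]
    {N : Set X} (hN : IsClosed N) (hN' : interior N = ∅) : N.Countable := by
  classical
  rcases N.eq_empty_or_nonempty with rfl | hN₀
  · exact countable_empty
  obtain ⟨a, ha⟩ := hN₀
  have hdense : Dense Nᶜ := interior_eq_empty_iff_dense_compl.1 hN'
  choose y hyN hy using fun x ↦ mem_closure_iff_seq_limit.1 (hdense x)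
  refine (countable_of_separation (S := N \ {a}) fun F ↦ ?_).of_sdiff (countable_singleton a)
  set Y : Set X := ⋃ x ∈ insert a F, insert x (range (y x))
  have hY : IsClosed Y := (insert a F).finite_toSet.isClosed_biUnion fun x _ ↦
    (hy x).isCompact_insert_range.isClosed
  have hFY : ∀ x ∈ insert a F, x ∈ Y := fun x hx ↦ mem_biUnion hx (mem_insert _ _)
  have hYN : ∀ z ∈ Y, z ∈ N → z ∈ insert a F := by
    intro z hz hzN
    obtain ⟨x, hx, rfl | ⟨k, rfl⟩⟩ := mem_iUnion₂.1 hz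
    · exact hx
    · exact absurd hzN (hyN x k)
  refine ⟨_, .infDist_div hY hN ⟨a, hFY a (Finset.mem_insert_self _ _)⟩ ⟨a, ha⟩ ?_, ?_, ?_⟩
  · rintro z ⟨hzY, hzN⟩
    exact mem_closure_of_tendsto (hy z) (.of_forall fun k ↦
      ⟨mem_biUnion (hYN z hzY hzN) (mem_insert_of_mem _ (mem_range_self k)), hyN z k⟩)
  · intro x hx
    simp [Metric.infDist_zero_of_mem (hFY x (Finset.mem_insert_of_mem hx))]
  · rintro x ⟨hxN, hxa⟩ hxF
    have hxY : x ∉ Y := fun h ↦ by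
      rcases Finset.mem_insert.1 (hYN x h hxN) with h | h
      exacts [hxa h, hxF h]
    have : Metric.infDist x Y ≠ 0 := fun h ↦ hxY ((hY.mem_iff_infDist_zero
      ⟨a, hFY a (Finset.mem_insert_self _ _)⟩).2 h)
    simp [Metric.infDist_zero_of_mem hxN, this]

theorem secondCountableTopology [MetricSpace X] [FrechetUrysohnSpace (Qp X)] :
    SecondCountableTopology X := by
  refine Metric.secondCountable_of_almost_dense_set fun ε hε ↦ ?_
  obtain ⟨S, hS⟩ := zorn_subset {S : Set X | S.Pairwise fun x y ↦ ε ≤ dist x y}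
    fun c hc hchain ↦ ⟨⋃₀ c, (pairwise_sUnion hchain.directedOn).2 hc,
      fun s hs ↦ subset_sUnion_of_mem hs⟩
  refine ⟨S, countable_of_separation fun F ↦ ?_, fun x ↦ ?_⟩
  · have hSF : IsClosed (S \ F) :=
      Metric.isClosed_of_pairwise_le_dist hε (hS.prop.mono sdiff_subset)
    obtain ⟨f, hf₀, hf₁, -⟩ := exists_continuous_zero_one_of_isClosed F.finite_toSet.isClosed hSF
      disjoint_sdiff_right
    exact ⟨f, .of_continuous f.continuous, fun x hx ↦ hf₀ hx, fun x hx hxF ↦ hf₁ ⟨hx, hxF⟩⟩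
  · by_contra! hx
    have hins : (insert x S).Pairwise fun x y ↦ ε ≤ dist x y :=
      hS.prop.insert fun y hy _ ↦ ⟨(hx y hy).le, dist_comm x y ▸ (hx y hy).le⟩
    have := hx x (hS.le_of_ge hins (subset_insert x S) (mem_insert x S))
    rw [dist_self] at this
    exact this.not_gt hε

/-- If nowhere dense closed sets are countable, so is `X`: otherwise `X` would be covered by
countably many closed sets whose interiors are countable. -/
theorem countable_of_nowhereDense_countable [TopologicalSpace X] [NormalSpace X] [T1Space X]
    [SecondCountableTopology X] [FrechetUrysohnSpace (Qp X)]
    (hX : ∀ N : Set X, IsClosed N → interior N = ∅ → N.Countable) : Countable X := by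
  classical
  rcases finite_or_infinite X with hfin | hinf
  · infer_instance
  let a := Infinite.natEmbedding X
  obtain ⟨B, hB, -⟩ := (TopologicalSpace.isBasis_countableBasis X).exists_subset_of_mem_open
    (mem_univ (a 0)) isOpen_univ
  obtain ⟨U, hU⟩ := (TopologicalSpace.countable_countableBasis X).exists_eq_range
    ⟨B, hB⟩
  have hbasis : TopologicalSpace.IsTopologicalBasis (range U) :=
    hU ▸ TopologicalSpace.isBasis_countableBasis X
  obtain ⟨g, hgA, hg⟩ := exists_seq_tendsto_zero (X := X)
    (A := {f | Continuous f ∧ ∃ n, f (a n) = 1 ∧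
      ∀ i < n, (U i).Infinite → ∃ p ∈ U i, f p = 1}) fun F ↦ by
    obtain ⟨_, ⟨n, rfl⟩, hn⟩ := (infinite_range_of_injective a.injective).exists_notMem_finset F
    choose! p hpU hpF using fun i (hi : (U i).Infinite) ↦ hi.exists_notMem_finset F
    set P : Finset X := insert (a n) (((Finset.range n).filter fun i ↦ (U i).Infinite).image p)
      with hP
    have hFP : Disjoint (F : Set X) P := by
      rw [Finset.disjoint_coe, Finset.disjoint_right]
      intro z hz
      rcases Finset.mem_insert.1 hz with rfl | hz
      · exact hn
      · obtain ⟨i, hi, rfl⟩ := Finset.mem_image.1 hz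
        exact hpF i (Finset.mem_filter.1 hi).2
    obtain ⟨f, hf₀, hf₁, -⟩ := exists_continuous_zero_one_of_isClosed F.finite_toSet.isClosed
      P.finite_toSet.isClosed hFP
    refine ⟨f, ⟨f.continuous, n, hf₁ (by simp [hP]), fun i hi hUi ↦ ⟨p i, hpU i hUi, hf₁ ?_⟩⟩,
      .of_continuous f.continuous, fun x hx ↦ hf₀ hx⟩
    exact Finset.mem_coe.2 (Finset.mem_insert_of_mem (Finset.mem_image_of_mem _
      (Finset.mem_filter.2 ⟨Finset.mem_range.2 hi, hUi⟩)))
  choose hgc n hgn hgU using hgA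
  have hn : Tendsto n atTop atTop := by
    refine tendsto_atTop.2 fun b ↦ ?_
    have : ∀ᶠ k in atTop, ∀ i ∈ Finset.range b, g k (a i) ≠ 1 :=
      (Filter.eventually_all_finset _).2 fun i _ ↦ (hg (a i)).eventually_ne zero_ne_one
    filter_upwards [this] with k hk
    by_contra! hlt
    exact hk (n k) (Finset.mem_range.2 hlt) (hgn k)
  let N : ℕ → Set X := fun m ↦ ⋂ k ≥ m, {x | g k x ≤ 1 / 2}
  have hNclosed : ∀ m, IsClosed (N m) := fun m ↦
    isClosed_biInter fun k _ ↦ isClosed_le (hgc k) continuous_const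
  have hint : ∀ m, (interior (N m)).Countable := by
    intro m
    refine (countable_iUnion fun i : {i // (U i).Finite} ↦ i.2.countable).mono fun x hx ↦ ?_
    obtain ⟨_, ⟨i, rfl⟩, hxi, hi⟩ := hbasis.exists_subset_of_mem_open hx isOpen_interior
    refine mem_iUnion.2 ⟨⟨i, ?_⟩, hxi⟩
    by_contra hinfi
    obtain ⟨k, hk, hkm⟩ := ((hn.eventually_gt_atTop i).and (eventually_ge_atTop m)).exists
    obtain ⟨p, hp, hp₁⟩ := hgU k i hk hinfi
    have : g k p ≤ 1 / 2 := mem_iInter₂.1 (interior_subset (hi hp)) k hkm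
    linarith
  have hNcount : ∀ m, (N m).Countable := fun m ↦ by
    refine ((hint m).union (hX _ isClosed_frontier (interior_frontier (hNclosed m)))).mono ?_
    rw [(hNclosed m).frontier_eq, union_sdiff_self]
    exact subset_union_right
  refine countable_univ_iff.1 ((countable_iUnion hNcount).mono fun x _ ↦ ?_)
  obtain ⟨m, hm⟩ := eventually_atTop.1 ((hg x).eventually_le_const (one_half_pos (α := ℝ)))
  exact mem_iUnion.2 ⟨m, mem_iInter₂.2 hm⟩

end Qp

theorem qp_frechetUrysohn_iff_countable_of_metrizable
    (X : Type*) [TopologicalSpace X] [TopologicalSpace.MetrizableSpace X] :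
    FrechetUrysohnSpace (Qp X) ↔ Countable X := by
  refine ⟨fun _ ↦ ?_, fun _ ↦ Qp.frechetUrysohnSpace_of_countable⟩
  let _ := TopologicalSpace.metrizableSpaceMetric X
  have := Qp.secondCountableTopology (X := X)
  exact Qp.countable_of_nowhereDense_countable fun _ ↦ Qp.countable_of_isClosed_of_interior_eq_empty
end

section
/- Let X be a Hausdorff semi-regular space such that the space Q_p(X,ℝ) of quasicontinuous real-valued functions on X with the topology of pointwise convergence is Fréchet–Urysohn at the point 0 (the constant zero function). Then X satisfies the selection principle S₁(Ω^s, Γ^s): for every sequence (𝒰_n)_{n∈ℕ} of ω-covers of X consisting of minimally bounded sets there exists a choice U_n ∈ 𝒰_n for each n such that {U_n : n ∈ ℕ} is a γ-cover of X consisting of minimally bounded sets. -/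
open Set Filter Topology

section Covers

variable {X : Type*}

/-- An ω-cover: every finite subset of `X` is contained in some member. -/
def IsOmegaCover (𝒰 : Set (Set X)) : Prop :=
  ∀ F : Set X, F.Finite → ∃ U ∈ 𝒰, F ⊆ U

/-- A γ-cover: every point of `X` lies outside only finitely many members. -/
def IsGammaCover (𝒰 : Set (Set X)) : Prop :=
  ∀ x : X, {U ∈ 𝒰 | x ∉ U}.Finite

/-- The selection principle `S₁(Ω^s, Γ^s)`. -/
def S1OmegaGammaMB (X : Type*) [TopologicalSpace X] : Prop :=
  ∀ 𝒰 : ℕ → Set (Set X),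
    (∀ n, (∀ U ∈ 𝒰 n, MinimallyBounded U) ∧ IsOmegaCover (𝒰 n)) →
    ∃ U : ℕ → Set X, (∀ n, U n ∈ 𝒰 n) ∧ (∀ n, MinimallyBounded (U n)) ∧
      IsGammaCover (Set.range U)

/-- Fréchet–Urysohn at a point. -/
def FrechetUrysohnAt {Y : Type*} [TopologicalSpace Y] (y : Y) : Prop :=
  ∀ A : Set Y, y ∈ closure A →
    ∃ u : ℕ → Y, (∀ n, u n ∈ A) ∧ Filter.Tendsto u Filter.atTop (nhds y)

theorem quasicontinuous_const [TopologicalSpace X] (c : ℝ) :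
    Quasicontinuous (fun _ : X => c) := by
  intro x U hU hxU V hV hfV
  exact ⟨U, hU, ⟨x, hxU⟩, subset_rfl, by rintro y ⟨z, _, rfl⟩; exact hfV⟩

end Covers

section Helpers

variable {X : Type*} [TopologicalSpace X]

/-- Any set between a regular open set and its closure is minimally bounded. -/
theorem minimallyBounded_of_subset_closure {S V : Set X} (hS : IsOpen S)
    (h₁ : interior (closure S) ⊆ V) (h₂ : V ⊆ closure S) : MinimallyBounded V := by
  refine ⟨h₂.trans (closure_mono ?_), ?_⟩
  · exact (interior_maximal subset_closure hS).trans (interior_maximal h₁ isOpen_interior)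
  · exact (interior_mono (closure_minimal h₂ isClosed_closure)).trans h₁

theorem MinimallyBounded.interior_closure_subset {U : Set X} (hU : MinimallyBounded U) :
    interior (closure U) ⊆ interior U :=
  interior_maximal hU.2 isOpen_interior

open Classical in
theorem MinimallyBounded.quasicontinuous_ite {V : Set X} (hV : MinimallyBounded V) (c d : ℝ) :
    Quasicontinuous (fun x => if x ∈ V then c else d) := by
  intro x U hU hxU T _ hfT
  by_cases hx : x ∈ V
  · refine ⟨U ∩ interior V, hU.inter isOpen_interior,
      mem_closure_iff.1 (hV.1 hx) U hU hxU, inter_subset_left, ?_⟩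
    rintro _ ⟨y, hy, rfl⟩
    simpa [hx, interior_subset hy.2] using hfT
  · have hx' : x ∈ closure (closure V)ᶜ := by
      rw [closure_compl]
      exact fun h => hx (hV.2 h)
    refine ⟨U ∩ (closure V)ᶜ, hU.inter isClosed_closure.isOpen_compl,
      mem_closure_iff.1 hx' U hU hxU, inter_subset_left, ?_⟩
    rintro _ ⟨y, hy, rfl⟩
    have hy' : y ∉ V := fun h => hy.2 (subset_closure h)
    simpa [hx, hy'] using hfT

/-- Selection of a convergent sequence from a ranked family of minimally bounded sets that contains
supersets of arbitrarily large rank of every finite set. -/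
theorem FrechetUrysohnAt.exists_seq_eventually_mem [Nonempty X]
    (hFU : FrechetUrysohnAt (⟨fun _ => 0, quasicontinuous_const 0⟩ : Qp X))
    {ι : Type*} (V : ι → Set X) (r : ι → ℕ) (hV : ∀ i, MinimallyBounded (V i))
    (hcov : ∀ F : Set X, F.Finite → ∀ N, ∃ i, N ≤ r i ∧ F ⊆ V i) :
    ∃ u : ℕ → ι, Tendsto (fun j => r (u j)) atTop atTop ∧ ∀ x, ∀ᶠ j in atTop, x ∈ V (u j) := by
  classical
  let f : ι → Qp X := fun i =>
    ⟨fun x => if x ∈ V i then 1 / ((r i : ℝ) + 1) else 1, (hV i).quasicontinuous_ite _ _⟩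
  have hmem : (⟨fun _ => 0, quasicontinuous_const 0⟩ : Qp X) ∈ closure (range f) := by
    refine closure_subtype.2 ?_
    have hbasis := hasBasis_pi fun _ : X => Metric.nhds_basis_ball (x := (0 : ℝ))
    rw [← nhds_pi] at hbasis
    refine (mem_closure_iff_nhds_basis hbasis).2 ?_
    rintro ⟨F, ε⟩ ⟨hF, hε⟩
    obtain ⟨δ, hδ, hδε⟩ : ∃ δ > 0, ∀ x ∈ F, δ ≤ ε x := by
      rcases F.eq_empty_or_nonempty with rfl | hne
      · exact ⟨1, one_pos, by simp⟩
      · obtain ⟨a, ha, hmin⟩ := hF.exists_minimalFor ε F hne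
        exact ⟨ε a, hε a ha, fun x hx => (le_total (ε a) (ε x)).elim id (hmin hx)⟩
    obtain ⟨N, hN⟩ := exists_nat_one_div_lt hδ
    obtain ⟨i, hi, hFi⟩ := hcov F hF N
    refine ⟨(f i).1, mem_image_of_mem _ (mem_range_self i), fun x hx => ?_⟩
    have hlt : 1 / ((r i : ℝ) + 1) < ε x :=
      ((one_div_le_one_div_of_le (by positivity) (by gcongr)).trans_lt hN).trans_le (hδε x hx)
    have hpos : (0 : ℝ) < (r i : ℝ) + 1 := by positivity
    simpa [f, hFi hx, Real.dist_eq, abs_of_pos hpos] using hlt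
  obtain ⟨v, hv, hlim⟩ := hFU _ hmem
  choose u hu using hv
  have hlim' : ∀ x, Tendsto (fun j => (f (u j)).1 x) atTop (𝓝 0) := by
    intro x
    have := ((continuous_apply x).comp continuous_subtype_val).continuousAt.tendsto.comp hlim
    simpa [Function.comp_def, hu] using this
  refine ⟨u, ?_, fun x => ?_⟩
  · obtain ⟨x⟩ := ‹Nonempty X›
    rw [tendsto_atTop]
    intro N
    filter_upwards [(hlim' x).eventually_lt_const (u := 1 / ((N : ℝ) + 1)) (by positivity)]
      with j hj
    have hle : 1 / ((r (u j) : ℝ) + 1) ≤ (f (u j)).1 x := by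
      dsimp only [f]
      split_ifs
      · exact le_rfl
      · rw [div_le_one (by positivity)]
        linarith [(Nat.cast_nonneg (r (u j)) : (0 : ℝ) ≤ _)]
    have := lt_of_one_div_lt_one_div (by positivity) (hle.trans_lt hj)
    have h2 : (N : ℝ) < r (u j) := by linarith
    exact (Nat.cast_lt.1 h2).le
  · filter_upwards [(hlim' x).eventually_lt_const one_pos] with j hj
    by_contra hx
    simp [f, hx] at hj

/-- From an ω-cover by minimally bounded sets one can extract a sequence whose interiors already
eventually contain every point outside some countable set. -/
theorem FrechetUrysohnAt.exists_seq_eventually_mem_interior [Nonempty X]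
    (hFU : FrechetUrysohnAt (⟨fun _ => 0, quasicontinuous_const 0⟩ : Qp X))
    {𝒰 : Set (Set X)} (hmb : ∀ U ∈ 𝒰, MinimallyBounded U) (hω : IsOmegaCover 𝒰) :
    ∃ (U : ℕ → Set X) (C : Set X), (∀ k, U k ∈ 𝒰) ∧ C.Countable ∧
      (∀ x, ∀ᶠ k in atTop, x ∈ U k) ∧ ∀ x ∉ C, ∀ᶠ k in atTop, x ∈ interior (U k) := by
  choose φ hφ hφF using fun F : Finset X => hω F F.finite_toSet
  obtain ⟨u, -, hu⟩ := hFU.exists_seq_eventually_mem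
    (fun p : Finset X × ℕ => interior (φ p.1) ∪ (p.1 : Set X)) Prod.snd
    (fun p => by
      have h := hmb _ (hφ p.1)
      refine minimallyBounded_of_subset_closure (S := interior (φ p.1)) isOpen_interior ?_ ?_
      · exact ((interior_mono (closure_mono interior_subset)).trans
          h.interior_closure_subset).trans subset_union_left
      · exact union_subset subset_closure ((hφF p.1).trans h.1))
    (fun F hF N => ⟨(hF.toFinset, N), le_rfl, by simp⟩)
  refine ⟨fun k => φ (u k).1, ⋃ k, ((u k).1 : Set X), fun k => hφ _,
    countable_iUnion fun k => (u k).1.countable_toSet, fun x => ?_, fun x hx => ?_⟩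
  · filter_upwards [hu x] with k hk
    exact hk.elim (fun h => interior_subset h) fun h => hφF _ h
  · filter_upwards [hu x] with k hk
    exact hk.resolve_right fun h => hx (mem_iUnion.2 ⟨k, h⟩)

/-- Near finitely many points, each in the closures of two disjoint open sets, there is an open set
accumulating at these points, but neither containing them in the interior of its closure nor
accumulating at finitely many given other points. -/
theorem exists_isOpen_subset_closure [T2Space X] {F E : Set X} (hF : F.Finite) (hE : E.Finite)
    (hFE : Disjoint F E)
    (hbad : ∀ b ∈ F, ∃ P Q : Set X, IsOpen P ∧ IsOpen Q ∧ Disjoint P Q ∧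
      b ∈ closure P ∧ b ∈ closure Q) :
    ∃ W : Set X, IsOpen W ∧ F ⊆ closure W ∧ F ⊆ closure (closure W)ᶜ ∧
      Disjoint E (closure W) := by
  obtain ⟨S, hS, hdisj⟩ := (hF.union hE).t2_separation
  choose! P Q hP hQ hPQ hbP hbQ using hbad
  have hW : IsOpen (⋃ b ∈ F, P b ∩ S b) :=
    isOpen_biUnion fun b hb => (hP b hb).inter (hS b).2
  refine ⟨⋃ b ∈ F, P b ∩ S b, hW, fun b hb => ?_, fun b hb => ?_, ?_⟩
  · refine closure_mono (subset_biUnion_of_mem (u := fun b => P b ∩ S b) hb) ?_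
    rw [inter_comm]
    exact (hS b).2.inter_closure ⟨(hS b).1, hbP b hb⟩
  · have hb' : b ∈ closure (S b ∩ Q b) := (hS b).2.inter_closure ⟨(hS b).1, hbQ b hb⟩
    refine closure_mono ?_ hb'
    rw [subset_compl_iff_disjoint_right]
    refine Disjoint.closure_right ?_ ((hS b).2.inter (hQ b hb))
    rw [disjoint_iUnion₂_right]
    intro c hc
    rcases eq_or_ne b c with rfl | hne
    · exact (hPQ b hb).symm.mono inter_subset_right inter_subset_left
    · exact (hdisj (Or.inl hb) (Or.inl hc) hne).mono inter_subset_left inter_subset_right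
  · rw [Set.disjoint_left]
    intro e he
    have : Disjoint (S e) (closure (⋃ b ∈ F, P b ∩ S b)) := by
      refine Disjoint.closure_right ?_ (hS e).2
      rw [disjoint_iUnion₂_right]
      intro c hc
      have hne : e ≠ c := fun h => Set.disjoint_left.1 hFE hc (h ▸ he)
      exact (hdisj (Or.inr he) (Or.inl hc) hne).mono_right inter_subset_right
    exact Set.disjoint_left.1 this (hS e).1

/-- For a countable set of points, each in the closures of two disjoint open sets, there are open
sets eventually accumulating at each of these points but eventually not at any other point. -/
theorem FrechetUrysohnAt.exists_seq_isOpen_accumulating [Nonempty X] [T2Space X]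
    (hFU : FrechetUrysohnAt (⟨fun _ => 0, quasicontinuous_const 0⟩ : Qp X))
    {B : Set X} (hB : B.Countable)
    (hbad : ∀ b ∈ B, ∃ P Q : Set X, IsOpen P ∧ IsOpen Q ∧ Disjoint P Q ∧
      b ∈ closure P ∧ b ∈ closure Q) :
    ∃ G W : ℕ → Set X, (∀ j, (G j).Finite) ∧ (∀ j, G j ⊆ B) ∧ (∀ j, IsOpen (W j)) ∧
      (∀ j, G j ⊆ closure (W j)) ∧ (∀ b ∈ B, ∀ᶠ j in atTop, b ∈ G j) ∧
      ∀ x ∉ B, ∀ᶠ j in atTop, x ∉ closure (W j) := by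
  obtain ⟨e, he⟩ := Set.countable_iff_exists_subset_range.1 hB
  let F : ℕ → Set X := fun n => B ∩ e '' Iic n
  have hFfin : ∀ n, (F n).Finite := fun n => ((finite_Iic n).image e).inter_of_right B
  have hFB : ∀ n, F n ⊆ B := fun n => inter_subset_left
  have hFev : ∀ b ∈ B, ∀ᶠ n in atTop, b ∈ F n := by
    intro b hb
    obtain ⟨m, rfl⟩ := he hb
    filter_upwards [eventually_ge_atTop m] with n hn
    exact ⟨hb, mem_image_of_mem e hn⟩
  let ι := {p : ℕ × Set X // IsOpen p.2 ∧ F p.1 ⊆ closure p.2 ∧ F p.1 ⊆ closure (closure p.2)ᶜ}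
  obtain ⟨u, hr, hu⟩ := hFU.exists_seq_eventually_mem
    (fun p : ι => (closure p.1.2)ᶜ ∪ F p.1.1) (fun p => p.1.1)
    (fun p => by
      refine minimallyBounded_of_subset_closure isClosed_closure.isOpen_compl ?_
        (union_subset subset_closure p.2.2.2)
      refine Subset.trans ?_ subset_union_left
      rw [closure_compl, interior_compl]
      exact compl_subset_compl.2 (closure_mono (interior_maximal subset_closure p.2.1)))
    (fun E hE N => by
      obtain ⟨W, hW, h₁, h₂, h₃⟩ := exists_isOpen_subset_closure (hFfin N)
        (hE.sdiff (t := F N)) disjoint_sdiff_right fun b hb => hbad b (hFB N hb)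
      refine ⟨⟨(N, W), hW, h₁, h₂⟩, le_rfl, fun x hx => ?_⟩
      by_cases hxF : x ∈ F N
      · exact Or.inr hxF
      · exact Or.inl (Set.disjoint_left.1 h₃ ⟨hx, hxF⟩))
  refine ⟨fun j => F (u j).1.1, fun j => (u j).1.2, fun j => hFfin _, fun j => hFB _,
    fun j => (u j).2.1, fun j => (u j).2.2.1, fun b hb => hr.eventually (hFev b hb),
    fun x hx => ?_⟩
  filter_upwards [hu x] with j hj
  exact hj.resolve_right fun h => hx (hFB _ h)

theorem mem_interior_closure_of_union {A W : Set X} {x : X}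
    (hx : x ∈ interior (closure (A ∪ W))) (hxW : x ∉ closure W) : x ∈ interior (closure A) := by
  have hopen : IsOpen (interior (closure (A ∪ W)) ∩ (closure W)ᶜ) :=
    isOpen_interior.inter isClosed_closure.isOpen_compl
  refine interior_maximal ?_ hopen ⟨hx, hxW⟩
  rintro y ⟨hy, hyW⟩
  have := interior_subset hy
  rw [closure_union] at this
  exact this.resolve_right hyW

/-- Simultaneous choice from sequences of minimally bounded sets which eventually contain each
point, in their interiors if the point is outside a suitable countable set. -/
theorem FrechetUrysohnAt.exists_diagonal_seq [Nonempty X] [T2Space X]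
    (hFU : FrechetUrysohnAt (⟨fun _ => 0, quasicontinuous_const 0⟩ : Qp X))
    {U : ℕ → ℕ → Set X} (hmb : ∀ n k, MinimallyBounded (U n k))
    (hU : ∀ n x, ∀ᶠ k in atTop, x ∈ U n k) {C : Set X} (hC : C.Countable)
    (hint : ∀ n, ∀ x ∉ C, ∀ᶠ k in atTop, x ∈ interior (U n k)) :
    ∃ g : ℕ → ℕ, ∀ x, ∀ᶠ n in atTop, x ∈ U n (g n) := by
  let B : Set X := {b ∈ C | ∃ P Q : Set X, IsOpen P ∧ IsOpen Q ∧ Disjoint P Q ∧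
      b ∈ closure P ∧ b ∈ closure Q}
  have hintB : ∀ n, ∀ x ∉ B, ∀ᶠ k in atTop, x ∈ interior (U n k) := by
    intro n x hxB
    by_cases hxC : x ∈ C
    · filter_upwards [hU n x] with k hk
      by_contra hxi
      refine hxB ⟨hxC, interior (U n k), (closure (U n k))ᶜ, isOpen_interior,
        isClosed_closure.isOpen_compl, ?_, (hmb n k).1 hk, ?_⟩
      · exact disjoint_compl_right.mono_left (interior_subset.trans subset_closure)
      · rw [closure_compl]
        exact fun h => hxi ((hmb n k).interior_closure_subset h)
    · exact hint n x hxC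
  obtain ⟨G, W, hGfin, hGB, hW, hGW, hGev, hWev⟩ :=
    hFU.exists_seq_isOpen_accumulating (hC.mono (sep_subset _ _) : B.Countable) fun b hb => hb.2
  let A : ℕ → (ℕ → ℕ) → Set X := fun j k => ⋂ i ∈ Iic j, interior (U i (k i))
  have hA : ∀ j k, IsOpen (A j k) := fun j k =>
    (finite_Iic j).isOpen_biInter fun _ _ => isOpen_interior
  let ι := {p : ℕ × (ℕ → ℕ) // ∀ i ≤ p.1, G p.1 ⊆ U i (p.2 i)}
  obtain ⟨u, hr, hu⟩ := hFU.exists_seq_eventually_mem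
    (fun p : ι => interior (closure (A p.1.1 p.1.2 ∪ W p.1.1)) ∪ G p.1.1) (fun p => p.1.1)
    (fun p => minimallyBounded_of_subset_closure ((hA _ _).union (hW _)) subset_union_left
      (union_subset interior_subset ((hGW _).trans (closure_mono subset_union_right))))
    (fun F hF N => by
      have hFB : ∀ᶠ j in atTop, ∀ b ∈ F ∩ B, b ∈ G j :=
        (hF.inter_of_left B).eventually_all.2 fun b hb => hGev b hb.2
      obtain ⟨j, hj, hNj⟩ := (hFB.and (eventually_ge_atTop N)).exists
      have hk : ∀ i, ∃ k, (∀ x ∈ G j, x ∈ U i k) ∧ ∀ x ∈ F \ B, x ∈ interior (U i k) := fun i =>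
        (((hGfin j).eventually_all.2 fun x _ => hU i x).and
          (hF.sdiff.eventually_all.2 fun x hx => hintB i x hx.2)).exists
      choose k hkG hkF using hk
      refine ⟨⟨(j, k), fun i _ => hkG i⟩, hNj, fun x hx => ?_⟩
      by_cases hxB : x ∈ B
      · exact Or.inr (hj x ⟨hx, hxB⟩)
      · refine Or.inl (interior_maximal subset_closure ((hA _ _).union (hW _)) (Or.inl ?_))
        exact mem_iInter₂.2 fun i _ => hkF i x ⟨hx, hxB⟩)
  have key : ∀ x, ∀ᶠ t in atTop, ∀ i ≤ (u t).1.1, x ∈ U i ((u t).1.2 i) := by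
    intro x
    by_cases hxB : x ∈ B
    · filter_upwards [hr.eventually (hGev x hxB)] with t ht i hi
      exact (u t).2 i hi ht
    · filter_upwards [hu x, hr.eventually (hWev x hxB)] with t ht htW i hi
      have h := mem_interior_closure_of_union (ht.resolve_right fun h => hxB (hGB _ h)) htW
      refine (hmb _ _).2 (interior_mono (closure_mono ?_) h)
      exact (biInter_subset_of_mem (mem_Iic.2 hi)).trans interior_subset
  choose t ht htr using fun n : ℕ =>
    ((eventually_ge_atTop n).and (hr.eventually (eventually_ge_atTop n))).exists
  exact ⟨fun n => (u (t n)).1.2 n, fun x =>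
    ((tendsto_atTop_mono ht tendsto_id).eventually (key x)).mono fun n hn => hn n (htr n)⟩

end Helpers

theorem s1_of_qp_frechetUrysohnAt_zero
    (X : Type*) [TopologicalSpace X] [T2Space X] (hsr : SemiRegular X)
    (hFU : FrechetUrysohnAt (⟨fun _ => 0, quasicontinuous_const 0⟩ : Qp X)) :
    S1OmegaGammaMB X := by
  intro 𝒰 h𝒰
  suffices ∃ U : ℕ → Set X, (∀ n, U n ∈ 𝒰 n) ∧ ∀ x, ∀ᶠ n in atTop, x ∈ U n by
    obtain ⟨U, hU, hev⟩ := this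
    refine ⟨U, hU, fun n => (h𝒰 n).1 _ (hU n), fun x => ?_⟩
    have hfin : {n | x ∉ U n}.Finite := by
      have := hev x
      rwa [← Nat.cofinite_eq_atTop, eventually_cofinite] at this
    refine (hfin.image U).subset ?_
    rintro _ ⟨⟨n, rfl⟩, hx⟩
    exact mem_image_of_mem U hx
  rcases isEmpty_or_nonempty X with hX | hX
  · choose U hU _ using fun n => (h𝒰 n).2 ∅ finite_empty
    exact ⟨U, hU, fun x => hX.elim x⟩
  · choose U C hU hC hev hint using fun n =>
      hFU.exists_seq_eventually_mem_interior (h𝒰 n).1 (h𝒰 n).2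
    obtain ⟨g, hg⟩ := hFU.exists_diagonal_seq (fun n k => (h𝒰 n).1 _ (hU n k)) hev
      (countable_iUnion hC) fun n x hx => hint n x fun h => hx (mem_iUnion.2 ⟨n, h⟩)
    exact ⟨fun n => U n (g n), fun n => hU n (g n), hg⟩
end

section
/- Let X be a Hausdorff semi-regular space with a dense subset D consisting of isolated points of X, and suppose D = D₁ ∪ D₂ where D₁ ∩ D₂ = ∅, cl(D₁) = X \ D₂ and cl(D₂) = X \ D₁. If the space Q_p(X,ℝ) of quasicontinuous real-valued functions on X with the topology of pointwise convergence is Fréchet–Urysohn, then D is countable. -/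
open Set Filter Topology

open Classical in
/-- The function vanishing on `A \ F` and equal to `1` elsewhere. -/
noncomputable def oneOff {X : Type*} (A : Set X) (F : Finset X) (x : X) : ℝ :=
  if x ∈ A ∧ x ∉ F then 0 else 1

theorem quasicontinuous_oneOff {X : Type*} [TopologicalSpace X] {A B : Set X}
    (hA : ∀ x ∈ A, IsOpen ({x} : Set X)) (hB : ∀ x ∈ B, IsOpen ({x} : Set X))
    (hAB : Disjoint A B) (hcl : Aᶜ ⊆ closure B) (F : Finset X) :
    Quasicontinuous (oneOff A F) := by
  intro x U hU hxU V _ hxV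
  by_cases hx : x ∈ A
  · exact ⟨{x}, hA x hx, singleton_nonempty x, by simpa using hxU, by simpa using hxV⟩
  · obtain ⟨b, hbU, hbB⟩ := mem_closure_iff.1 (hcl hx) U hU hxU
    have hbA : b ∉ A := fun h => hAB.notMem_of_mem_left h hbB
    refine ⟨{b}, hB b hbB, singleton_nonempty b, by simpa using hbU, ?_⟩
    simpa [oneOff, hx, hbA] using hxV

theorem countable_of_frechetUrysohn_Qp {X : Type*} [TopologicalSpace X]
    [FrechetUrysohnSpace (Qp X)] {A B : Set X}
    (hA : ∀ x ∈ A, IsOpen ({x} : Set X)) (hB : ∀ x ∈ B, IsOpen ({x} : Set X))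
    (hAB : Disjoint A B) (hcl : Aᶜ ⊆ closure B) : A.Countable := by
  let φ : Finset X → Qp X := fun F => ⟨oneOff A F, quasicontinuous_oneOff hA hB hAB hcl F⟩
  have hone : Quasicontinuous (fun _ : X => (1 : ℝ)) := fun x U hU hxU V _ hV =>
    ⟨U, hU, ⟨x, hxU⟩, Subset.rfl, by rintro _ ⟨_, _, rfl⟩; exact hV⟩
  have hlim : Tendsto φ atTop (𝓝 (⟨fun _ => 1, hone⟩ : Qp X)) := by
    rw [tendsto_subtype_rng, tendsto_pi_nhds]
    intro x
    refine tendsto_const_nhds.congr' ?_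
    filter_upwards [eventually_ge_atTop ({x} : Finset X)] with F hF
    have hxF : x ∈ F := hF (Finset.mem_singleton_self x)
    simp [φ, oneOff, hxF]
  have hmem := mem_closure_of_tendsto hlim (Eventually.of_forall fun F => mem_range_self F)
  obtain ⟨u, hu, hulim⟩ := mem_closure_iff_seq_limit.1 hmem
  choose F hF using hu
  refine (countable_iUnion fun n => (F n).countable_toSet).mono fun x hx => ?_
  rw [tendsto_subtype_rng, tendsto_pi_nhds] at hulim
  obtain ⟨n, hn⟩ := ((hulim x).eventually_ne one_ne_zero).exists
  refine mem_iUnion.2 ⟨n, ?_⟩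
  by_contra hxF
  refine hn ?_
  rw [← hF n]
  exact if_pos ⟨hx, hxF⟩

theorem dense_isolated_split_countable
    (X : Type*) [TopologicalSpace X] [T2Space X] (hsr : SemiRegular X)
    (D D₁ D₂ : Set X) (hdense : Dense D) (hiso : ∀ x ∈ D, IsOpen ({x} : Set X))
    (hunion : D = D₁ ∪ D₂) (hdisj : D₁ ∩ D₂ = ∅)
    (h1 : closure D₁ = Set.univ \ D₂) (h2 : closure D₂ = Set.univ \ D₁)
    (hFU : FrechetUrysohnSpace (Qp X)) :
    D.Countable := by
  subst hunion
  have hd : Disjoint D₁ D₂ := Set.disjoint_iff_inter_eq_empty.2 hdisj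
  have hi₁ : ∀ x ∈ D₁, IsOpen ({x} : Set X) := fun x hx => hiso x (Or.inl hx)
  have hi₂ : ∀ x ∈ D₂, IsOpen ({x} : Set X) := fun x hx => hiso x (Or.inr hx)
  exact (countable_of_frechetUrysohn_Qp hi₁ hi₂ hd (by rw [h2, compl_eq_univ_sdiff])).union
    (countable_of_frechetUrysohn_Qp hi₂ hi₁ hd.symm (by rw [h1, compl_eq_univ_sdiff]))
end

section
/- Let X = ω₁ + 1 be the set of all ordinals less than or equal to the first uncountable ordinal ω₁, equipped with the order topology. Then the space Q_p(X,ℝ) of quasicontinuous real-valued functions on X with the topology of pointwise convergence is not Fréchet–Urysohn. -/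
open Set Filter Topology

theorem indicator_one_eq_of_mem_iff {X Y : Type*} {A : Set X} {B : Set Y} {x : X} {y : Y}
    (h : x ∈ A ↔ y ∈ B) : A.indicator (1 : X → ℝ) x = B.indicator (1 : Y → ℝ) y := by
  by_cases hy : y ∈ B <;> simp [hy, h]

/-- In a well-ordered space, every initial segment `Iic x` is open. -/
theorem isOpen_Iic_of_wellFoundedLT {X : Type*} [LinearOrder X] [WellFoundedLT X]
    [TopologicalSpace X] [OrderTopology X] (x : X) : IsOpen (Iic x) := by
  by_cases hx : IsMax x
  · rw [show Iic x = univ from eq_univ_of_forall fun y => hx.isTop y]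
    exact isOpen_univ
  · obtain ⟨z, hz⟩ := exists_covBy_of_wellFoundedLT hx
    rw [← hz.Iio_eq]
    exact isOpen_Iio

theorem isOpen_singleton_of_covBy {X : Type*} [LinearOrder X] [WellFoundedLT X]
    [TopologicalSpace X] [OrderTopology X] {x y : X} (h : y ⋖ x) : IsOpen {x} := by
  rw [show ({x} : Set X) = Ioi y ∩ Iic x by rw [h.Ioi_eq, Ici_inter_Iic, Icc_self]]
  exact isOpen_Ioi.inter (isOpen_Iic_of_wellFoundedLT x)

/-- In a well-ordered space, the indicator of a set that alternates between consecutive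
successor points is quasicontinuous, whatever its values at limit points. -/
theorem quasicontinuous_indicator_of_alternating {X : Type*} [LinearOrder X] [WellFoundedLT X]
    [TopologicalSpace X] [OrderTopology X] {T : Set X}
    (hT : ∀ a b c : X, a ⋖ b → b ⋖ c → (c ∈ T ↔ b ∉ T)) :
    Quasicontinuous (T.indicator (1 : X → ℝ)) := by
  intro x U hU hxU V _ hxV
  suffices h : ∃ w ∈ U, IsOpen {w} ∧ (w ∈ T ↔ x ∈ T) by
    obtain ⟨w, hwU, hw, hwT⟩ := h
    refine ⟨{w}, hw, singleton_nonempty w, singleton_subset_iff.2 hwU, ?_⟩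
    rw [image_singleton, singleton_subset_iff]
    rwa [indicator_one_eq_of_mem_iff hwT]
  by_cases hx : IsOpen {x}
  · exact ⟨x, hxU, hx, Iff.rfl⟩
  have hcov : ∀ {y}, y < x → ∃ z, y ⋖ z ∧ z < x := by
    intro y hy
    obtain ⟨z, hz⟩ := exists_covBy_of_wellFoundedLT hy.not_isMax
    refine ⟨z, hz, lt_of_le_of_ne (hz.ge_of_gt hy) ?_⟩
    rintro rfl
    exact hx (isOpen_singleton_of_covBy hz)
  have hmin : ∃ l, l < x := by
    by_contra! h
    refine hx ?_
    rw [show ({x} : Set X) = Iic x from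
      (Subset.antisymm (by simp) fun y hy => le_antisymm hy (h y))]
    exact isOpen_Iic_of_wellFoundedLT x
  obtain ⟨l, hl, hlU⟩ := exists_Ioc_subset_of_mem_nhds (hU.mem_nhds hxU) hmin
  obtain ⟨b, hlb, hb⟩ := hcov hl
  obtain ⟨c, hbc, hc⟩ := hcov hb
  have hiff := hT l b c hlb hbc
  by_cases hbT : b ∈ T ↔ x ∈ T
  · exact ⟨b, hlU ⟨hlb.lt, hb.le⟩, isOpen_singleton_of_covBy hlb, hbT⟩
  · exact ⟨c, hlU ⟨hlb.lt.trans hbc.lt, hc.le⟩, isOpen_singleton_of_covBy hbc, by tauto⟩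

open Ordinal in
theorem Ordinal.succ_mod_omega0 (a : Ordinal) : Order.succ a % ω = Order.succ (a % ω) := by
  conv_lhs => rw [← Ordinal.div_add_mod a ω, Order.succ_eq_add_one, add_assoc,
    Ordinal.mul_add_mod_self, ← Order.succ_eq_add_one]
  exact Ordinal.mod_eq_of_lt (isSuccLimit_omega0.succ_lt (Ordinal.mod_lt a omega0_ne_zero))

open Ordinal in
/-- Ordinals with odd finite part, together with the multiples `ω * β` for `β ∈ S`. -/
def oddOrMulOmega (S : Set Ordinal) : Set Ordinal :=
  {a | (∃ n : ℕ, Odd n ∧ a % ω = n) ∨ (a % ω = 0 ∧ a / ω ∈ S)}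

open Ordinal in
theorem succ_mem_oddOrMulOmega (S : Set Ordinal) (a : Ordinal) :
    Order.succ a ∈ oddOrMulOmega S ↔ ∃ n : ℕ, Even n ∧ a % ω = n := by
  have h0 : Order.succ a % ω ≠ 0 := by
    rw [Ordinal.succ_mod_omega0]; exact (Order.bot_lt_succ _).ne'
  obtain ⟨m, hm⟩ := lt_omega0.1 (Ordinal.mod_lt a omega0_ne_zero)
  have hs : Order.succ a % ω = (m + 1 : ℕ) := by
    rw [Ordinal.succ_mod_omega0, hm, Nat.cast_succ, Order.succ_eq_add_one]
  simp only [oddOrMulOmega, mem_ofPred_eq, h0, false_and, or_false]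
  rw [hs, hm]
  simp only [Nat.cast_inj, exists_eq_right', Nat.odd_add_one, Nat.not_odd_iff_even]

open Ordinal in
theorem succ_succ_mem_oddOrMulOmega (S : Set Ordinal) (a : Ordinal) :
    Order.succ (Order.succ a) ∈ oddOrMulOmega S ↔ Order.succ a ∉ oddOrMulOmega S := by
  rw [succ_mem_oddOrMulOmega, succ_mem_oddOrMulOmega]
  obtain ⟨m, hm⟩ := lt_omega0.1 (Ordinal.mod_lt a omega0_ne_zero)
  have hs : Order.succ a % ω = (m + 1 : ℕ) := by
    rw [Ordinal.succ_mod_omega0, hm, Nat.cast_succ, Order.succ_eq_add_one]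
  rw [hs, hm]
  simp only [Nat.cast_inj, exists_eq_right', Nat.even_add_one]

open Ordinal in
theorem omega0_mul_mem_oddOrMulOmega (S : Set Ordinal) (b : Ordinal) :
    ω * b ∈ oddOrMulOmega S ↔ b ∈ S := by
  have hn (n : ℕ) (hn : Odd n) : (0 : Ordinal) ≠ n := by
    exact_mod_cast hn.pos.ne
  simp only [oddOrMulOmega, mem_ofPred_eq, Ordinal.mul_mod, true_and,
    Ordinal.mul_div_cancel b omega0_ne_zero]
  constructor
  · rintro (⟨n, h, h'⟩ | h)
    exacts [(hn n h h').elim, h]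
  · exact Or.inr

theorem quasicontinuous_indicator_oddOrMulOmega {X : Type*} [LinearOrder X] [TopologicalSpace X]
    [OrderTopology X] {o : Ordinal} (e : X ≃o Set.Iic o) (S : Set Ordinal) :
    Quasicontinuous (((fun x => (e x : Ordinal)) ⁻¹' oddOrMulOmega S).indicator (1 : X → ℝ)) := by
  have : WellFoundedLT X := ⟨(e.toOrderEmbedding.ltEmbedding).wellFounded wellFounded_lt⟩
  have hsucc {a b : X} (h : a ⋖ b) : (e b : Ordinal) = Order.succ (e a : Ordinal) := by
    have h1 : e a ⋖ e b := (apply_covBy_apply_iff e).2 h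
    have h2 : (e a : Ordinal) ⋖ e b :=
      (OrdConnected.apply_covBy_apply_iff (OrderEmbedding.subtype _)
        (by rw [OrderEmbedding.coe_subtype, Subtype.range_val]; exact ordConnected_Iic)).2 h1
    exact h2.succ_eq.symm
  refine quasicontinuous_indicator_of_alternating fun a b c hab hbc => ?_
  rw [mem_preimage, mem_preimage, hsucc hbc, hsucc hab]
  exact succ_succ_mem_oddOrMulOmega S _

open Ordinal Cardinal in
theorem exists_omega0_mul_lt_notMem_of_countable {S : Set Ordinal} (hS : S.Countable) :
    ∃ b, b ∉ S ∧ ω * b < (aleph 1).ord := by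
  by_contra! h
  have hsub : Iio (aleph 1).ord ⊆ S := by
    intro b hb
    by_contra hbS
    refine (h b hbS).not_gt ?_
    rw [lt_ord, card_mul, card_omega0]
    exact mul_lt_of_lt aleph0_lt_aleph_one.le aleph0_lt_aleph_one (lt_ord.1 hb)
  have hc := (hS.mono hsub).le_aleph0
  rw [Cardinal.mk_Iio_ordinal, card_ord, Cardinal.lift_le_aleph0] at hc
  exact hc.not_gt aleph0_lt_aleph_one

theorem qp_omega1_succ_not_frechetUrysohn
    (X : Type*) [LinearOrder X] [TopologicalSpace X] [OrderTopology X]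
    (e : X ≃o (Set.Iic (Cardinal.aleph 1).ord : Set Ordinal)) :
    ¬ FrechetUrysohnSpace (Qp X) := by
  intro _
  let f (S : Set Ordinal) : Qp X := ⟨_, quasicontinuous_indicator_oddOrMulOmega e S⟩
  have hcl : f univ ∈ closure (f '' {S | S.Countable}) := by
    refine mem_closure_of_tendsto
      (f := fun F : Finset X => f ((fun x => (e x : Ordinal) / Ordinal.omega0) '' (F : Set X)))
      (b := atTop) ?_
      (Eventually.of_forall fun F => mem_image_of_mem f (F.countable_toSet.image _))
    rw [tendsto_subtype_rng, tendsto_pi_nhds]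
    intro x
    refine tendsto_nhds_of_eventually_eq ?_
    filter_upwards [eventually_ge_atTop {x}] with F hF
    have hxF : x ∈ F := Finset.singleton_subset_iff.1 hF
    have hmem : (e x : Ordinal) / Ordinal.omega0 ∈
        (fun x => (e x : Ordinal) / Ordinal.omega0) '' (F : Set X) := ⟨x, hxF, rfl⟩
    refine indicator_one_eq_of_mem_iff ?_
    simp only [mem_preimage, oddOrMulOmega, mem_ofPred_eq, hmem, mem_univ]
  obtain ⟨u, hu, hlim⟩ := mem_closure_iff_seq_limit.1 hcl
  choose S hS hSu using hu
  obtain ⟨b, hb, hlt⟩ := exists_omega0_mul_lt_notMem_of_countable (countable_iUnion hS)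
  rw [tendsto_subtype_rng, tendsto_pi_nhds] at hlim
  have hx := hlim (e.symm ⟨_, hlt.le⟩)
  have hval (R : Set Ordinal) :
      (f R : X → ℝ) (e.symm ⟨_, hlt.le⟩) = R.indicator 1 b := by
    refine indicator_one_eq_of_mem_iff ?_
    rw [mem_preimage, OrderIso.apply_symm_apply, omega0_mul_mem_oddOrMulOmega]
  have hzero (n : ℕ) : (u n : X → ℝ) (e.symm ⟨_, hlt.le⟩) = 0 := by
    rw [← hSu, hval, indicator_of_notMem fun h => hb (mem_iUnion.2 ⟨n, h⟩)]
  simp only [hzero, hval, indicator_univ, Pi.one_apply] at hx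
  exact zero_ne_one (tendsto_nhds_unique tendsto_const_nhds hx)
end
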